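/- Suppose Assumption 1.1 holds with 1 < μ < 2 and the global nontrapping condition, and let (z_1(t,x,ξ), η_1(t,x,ξ)) = exp(−tH_{p_0})∘exp(tH_p)(x,ξ) and (z(t,x,ξ), η(t,x,ξ)) = exp(−tH_{p_0})∘exp(tH_k)(x,ξ). Then for any T > 0 and compact K ⊂ ℝ^n there is C with |z_1(t,x,ξ) − z(t,x,ξ)| ≤ C|t|⟨ξ⟩^{1−μ} and |η_1(t,x,ξ) − η(t,x,ξ)| ≤ C⟨ξ⟩^{1−μ} for all |t| ≤ T, x ∈ K, ξ ∈ ℝ^n. -/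

import Mathlib

open Filter

/-- Hamilton vector field of p on T*ℝⁿ = ℝⁿ × ℝⁿ. -/
noncomputable def hamVF (n : ℕ) (p : (Fin n → ℝ) × (Fin n → ℝ) → ℝ)
    (z : (Fin n → ℝ) × (Fin n → ℝ)) : (Fin n → ℝ) × (Fin n → ℝ) :=
  (fun j => fderiv ℝ p z (0, Pi.single j 1),
   fun j => - fderiv ℝ p z (Pi.single j 1, 0))

/-- Kinetic energy k(x,ξ) = (1/2) Σ_{j,l} a_{jl}(x) ξ_j ξ_l. -/
noncomputable def kin (n : ℕ) (a : Fin n → Fin n → (Fin n → ℝ) → ℝ)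
    (z : (Fin n → ℝ) × (Fin n → ℝ)) : ℝ :=
  (1 / 2) * ∑ j : Fin n, ∑ l : Fin n, a j l z.1 * z.2 j * z.2 l

def Sol {E : Type*} [NormedAddCommGroup E] [NormedSpace ℝ E]
    (f g : E → E → E) (W : E → E) (y θ : ℝ → E) : Prop :=
  ∀ t, HasDerivAt y (θ t + f (y t) (θ t)) t ∧ HasDerivAt θ (g (y t) (θ t) - W (y t)) t

lemma bootstrap {P : ℝ → Prop} (hP : IsOpen {t | P t}) (a b : ℝ)
    (h : ∀ τ ∈ Set.Icc a b, (∀ s ∈ Set.Ico a τ, P s) → P τ) :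
    ∀ τ ∈ Set.Icc a b, P τ := by
  by_contra hcon
  push Not at hcon
  obtain ⟨τ, hτ, hnP⟩ := hcon
  set S : Set ℝ := Set.Icc a b ∩ {t | P t}ᶜ with hS
  have hSc : IsCompact S := isCompact_Icc.inter_right hP.isClosed_compl
  have hne : S.Nonempty := ⟨τ, hτ, hnP⟩
  have hm := hSc.sInf_mem hne
  apply hm.2
  apply h _ hm.1
  intro s hs
  by_contra hns
  have hsS : s ∈ S := ⟨⟨hs.1, hs.2.le.trans hm.1.2⟩, hns⟩
  exact absurd (csInf_le hSc.bddBelow hsS) (not_le.mpr hs.2)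

lemma perturb_pointwise {E : Type*} [NormedAddCommGroup E] [NormedSpace ℝ E]
    (f g : E → E → E) (W : E → E) (κ C Λ M : ℝ) (hκ1 : κ < 1)
    (hC : 0 ≤ C) (hΛ : 0 < Λ) (hM : 0 ≤ M)
    (hf : ∀ r > 0, ∀ y y1 θ θ1 : E, (∀ z ∈ segment ℝ y y1, r ≤ 1 + ‖z‖) →
      ‖f y1 θ1 - f y θ‖ ≤ C * (‖θ1 - θ‖ / r + ‖y1 - y‖ * ‖θ‖ / r ^ 2))
    (hg : ∀ r > 0, ∀ y y1 θ θ1 : E, (∀ z ∈ segment ℝ y y1, r ≤ 1 + ‖z‖) →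
      ‖g y1 θ1 - g y θ‖ ≤ C * ((‖θ1‖ + ‖θ‖) * ‖θ1 - θ‖ / r ^ 2 + ‖y1 - y‖ * ‖θ‖ ^ 2 / r ^ 3))
    (hW : ∀ y, ‖W y‖ ≤ C * (1 + ‖y‖) ^ (κ - 1)) :
    ∃ C1 > 0, ∃ C2 > 0, ∀ (ε B τ : ℝ) (y θ y1 θ1 : E), 0 ≤ τ → 0 ≤ B → B ≤ 1 → 4 * Λ * B ≤ 1 →
      ‖θ‖ ≤ M → 1 + τ ≤ Λ * (1 + ‖y‖) → ‖θ1 - θ‖ ≤ B →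
      ‖(y1 - τ • θ1) - (y - τ • θ)‖ ≤ (1 + τ) * B →
      ‖(g y1 θ1 - ε ^ 2 • W y1) - g y θ‖
        ≤ C1 * B / (1 + τ) ^ 2 + C2 * ε ^ 2 * (1 + τ) ^ (κ - 1) ∧
      ‖(f y1 θ1 - τ • (g y1 θ1 - ε ^ 2 • W y1)) - (f y θ - τ • g y θ)‖
        ≤ (1 + τ) * (C1 * B / (1 + τ) ^ 2 + C2 * ε ^ 2 * (1 + τ) ^ (κ - 1)) := by
  set Kg := C * ((2 * M + 1) * (2 * Λ) ^ 2 + 2 * M ^ 2 * (2 * Λ) ^ 3) with hKg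
  set Kf := C * ((2 * Λ) + 2 * M * (2 * Λ) ^ 2) with hKf
  set Kw := C * (2 * Λ) ^ (1 - κ) with hKw
  have hKg0 : 0 ≤ Kg := by positivity
  have hKf0 : 0 ≤ Kf := by positivity
  have hKw0 : 0 ≤ Kw := by positivity
  refine ⟨Kg + Kf + 1, by positivity, Kw + 1, by positivity, ?_⟩
  intro ε B τ y θ y1 θ1 hτ hB hB1 hΛB hθ hy hu hζ
  set ρ := 1 + τ with hρ
  have hρ1 : 1 ≤ ρ := by linarith
  have hρ0 : 0 < ρ := by linarith
  have hw : ‖y1 - y‖ ≤ 2 * ρ * B := by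
    have : y1 - y = ((y1 - τ • θ1) - (y - τ • θ)) + τ • (θ1 - θ) := by
      rw [smul_sub]; abel
    rw [this]
    calc _ ≤ ‖(y1 - τ • θ1) - (y - τ • θ)‖ + ‖τ • (θ1 - θ)‖ := norm_add_le _ _
      _ ≤ ρ * B + τ * B := by
        rw [norm_smul, Real.norm_of_nonneg hτ]; gcongr
      _ ≤ 2 * ρ * B := by nlinarith
  set r := ρ / (2 * Λ) with hr
  have hr0 : 0 < r := by positivity
  have hseg : ∀ z ∈ segment ℝ y y1, r ≤ 1 + ‖z‖ := by
    intro z hz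
    have h1 : ‖z - y‖ ≤ ‖y1 - y‖ := by
      rw [segment_eq_image'] at hz
      obtain ⟨s, hs, rfl⟩ := hz
      simp only [add_sub_cancel_left, norm_smul, Real.norm_of_nonneg hs.1]
      exact mul_le_of_le_one_left (norm_nonneg _) hs.2
    have h2 : ‖y‖ ≤ ‖z‖ + ‖z - y‖ := by
      have := norm_sub_le z (z - y); simpa using this
    have h3 : ρ / Λ ≤ 1 + ‖y‖ := by rw [div_le_iff₀ hΛ]; linarith
    have h4 : 2 * ρ * B ≤ ρ / (2 * Λ) := by
      rw [le_div_iff₀ (by positivity)]; nlinarith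
    have h5 : ρ / Λ = ρ / (2 * Λ) + ρ / (2 * Λ) := by field_simp; norm_num
    linarith
  have hθ1 : ‖θ1‖ ≤ M + 1 := by
    have := norm_add_le (θ1 - θ) θ
    simp only [sub_add_cancel] at this
    linarith
  have hg' : ‖g y1 θ1 - g y θ‖ ≤ Kg * B / ρ ^ 2 := by
    refine (hg r hr0 y y1 θ θ1 hseg).trans ?_
    calc _ ≤ C * ((M + 1 + M) * B / r ^ 2 + 2 * ρ * B * M ^ 2 / r ^ 3) := by gcongr
      _ = Kg * B / ρ ^ 2 := by
        rw [hKg, hr]; field_simp; ring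
  have hf' : ‖f y1 θ1 - f y θ‖ ≤ Kf * B / ρ := by
    refine (hf r hr0 y y1 θ θ1 hseg).trans ?_
    calc _ ≤ C * (B / r + 2 * ρ * B * M / r ^ 2) := by gcongr
      _ = Kf * B / ρ := by
        rw [hKf, hr]; field_simp
  have hW' : ‖W y1‖ ≤ Kw * ρ ^ (κ - 1) := by
    refine (hW y1).trans ?_
    have h1 : (1 + ‖y1‖) ^ (κ - 1) ≤ r ^ (κ - 1) :=
      Real.rpow_le_rpow_of_nonpos hr0 (hseg y1 (right_mem_segment ℝ y y1)) (by linarith)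
    have h2 : r ^ (κ - 1) = (2 * Λ) ^ (1 - κ) * ρ ^ (κ - 1) := by
      rw [hr, Real.div_rpow hρ0.le (by positivity), div_eq_mul_inv, ← Real.rpow_neg (by positivity),
        mul_comm]
      congr 2; ring
    rw [hKw, mul_assoc, ← h2]
    gcongr
  have hu' : ‖(g y1 θ1 - ε ^ 2 • W y1) - g y θ‖
        ≤ Kg * B / ρ ^ 2 + Kw * ε ^ 2 * ρ ^ (κ - 1) := by
    have : (g y1 θ1 - ε ^ 2 • W y1) - g y θ = (g y1 θ1 - g y θ) - ε ^ 2 • W y1 := by abel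
    rw [this]
    refine (norm_sub_le _ _).trans ?_
    rw [norm_smul, Real.norm_of_nonneg (sq_nonneg ε)]
    have : ε ^ 2 * ‖W y1‖ ≤ ε ^ 2 * (Kw * ρ ^ (κ - 1)) := by gcongr
    linarith
  have hp : 0 ≤ ρ ^ (κ - 1) := by positivity
  constructor
  · refine hu'.trans ?_
    gcongr <;> linarith
  · have : (f y1 θ1 - τ • (g y1 θ1 - ε ^ 2 • W y1)) - (f y θ - τ • g y θ)
      = (f y1 θ1 - f y θ) - τ • ((g y1 θ1 - ε ^ 2 • W y1) - g y θ) := by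
      simp only [smul_sub]; abel
    rw [this]
    refine (norm_sub_le _ _).trans ?_
    rw [norm_smul, Real.norm_of_nonneg hτ]
    calc _ ≤ Kf * B / ρ + ρ * (Kg * B / ρ ^ 2 + Kw * ε ^ 2 * ρ ^ (κ - 1)) := by
          gcongr; linarith
      _ = ρ * ((Kg + Kf) * B / ρ ^ 2 + Kw * ε ^ 2 * ρ ^ (κ - 1)) := by
          field_simp; ring
      _ ≤ _ := by
          have h1 : Kg + Kf ≤ Kg + Kf + 1 := by linarith
          generalize Kg + Kf + 1 = K1 at h1 ⊢
          generalize Kg + Kf = K2 at h1 ⊢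
          gcongr
          linarith

theorem perturb {E : Type*} [NormedAddCommGroup E] [NormedSpace ℝ E]
    (f g : E → E → E) (W : E → E) (κ C Λ M T : ℝ) (hκ0 : 0 < κ) (hκ1 : κ < 1)
    (hC : 0 ≤ C) (hΛ : 0 < Λ) (hM : 0 ≤ M) (hT : 0 < T)
    (hf : ∀ r > 0, ∀ y y1 θ θ1 : E, (∀ z ∈ segment ℝ y y1, r ≤ 1 + ‖z‖) →
      ‖f y1 θ1 - f y θ‖ ≤ C * (‖θ1 - θ‖ / r + ‖y1 - y‖ * ‖θ‖ / r ^ 2))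
    (hg : ∀ r > 0, ∀ y y1 θ θ1 : E, (∀ z ∈ segment ℝ y y1, r ≤ 1 + ‖z‖) →
      ‖g y1 θ1 - g y θ‖ ≤ C * ((‖θ1‖ + ‖θ‖) * ‖θ1 - θ‖ / r ^ 2 + ‖y1 - y‖ * ‖θ‖ ^ 2 / r ^ 3))
    (hW : ∀ y, ‖W y‖ ≤ C * (1 + ‖y‖) ^ (κ - 1)) :
    ∃ A > 0, ∃ ε₀ > 0, ∀ ε > 0, ε ≤ ε₀ → ∀ y θ y1 θ1 : ℝ → E,
      Sol f g 0 y θ → Sol f g (ε ^ 2 • W) y1 θ1 → y1 0 = y 0 → θ1 0 = θ 0 →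
      (∀ τ ≥ 0, ‖θ τ‖ ≤ M) → (∀ τ ≥ 0, 1 + τ ≤ Λ * (1 + ‖y τ‖)) →
      ∀ τ, 0 ≤ τ → ε * τ ≤ T →
        ‖θ1 τ - θ τ‖ ≤ A * ε ^ (2 - κ) ∧
        ‖(y1 τ - τ • θ1 τ) - (y τ - τ • θ τ)‖ ≤ A * τ * ε ^ (2 - κ) := by
  obtain ⟨C1, hC1, C2, hC2, hpt⟩ := perturb_pointwise f g W κ C Λ M hκ1 hC hΛ hM hf hg hW
  set A0 := C2 / κ * Real.exp C1 with hA0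
  have hA0p : 0 < A0 := by positivity
  set A1 := A0 * (1 + T) ^ κ with hA1
  have hA1p : 0 < A1 := by positivity
  set A := A1 + (C1 * A1 + C2 * (1 + T) ^ κ) with hA
  refine ⟨A, by positivity, min 1 (1 / (A1 * (1 + 4 * Λ))), by positivity, ?_⟩
  intro ε hε hεle y θ y1 θ1 hS hS1 hy0 hθ0 hθM hyΛ τ hτ0 hτT
  have hε1 : ε ≤ 1 := hεle.trans (min_le_left _ _)
  have hε2 : ε * (A1 * (1 + 4 * Λ)) ≤ 1 := by
    have := hεle.trans (min_le_right _ _)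
    rwa [le_div_iff₀ (by positivity)] at this
  set B : ℝ → ℝ := fun s => ε ^ 2 * A0 * (1 + s) ^ κ * Real.exp (-C1 / (1 + s)) with hBdef
  have hρk : ∀ s, 0 ≤ s → s ≤ τ → ε ^ 2 * (1 + s) ^ κ ≤ (1 + T) ^ κ * ε ^ (2 - κ) := by
    intro s hs hsτ
    have h1 : 1 + s ≤ (1 + T) / ε := by
      rw [le_div_iff₀ hε]
      nlinarith
    have h2 : (1 + s) ^ κ ≤ ((1 + T) / ε) ^ κ := by gcongr
    rw [Real.div_rpow (by positivity) hε.le] at h2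
    calc ε ^ 2 * (1 + s) ^ κ ≤ ε ^ 2 * ((1 + T) ^ κ / ε ^ κ) := by gcongr
      _ = (1 + T) ^ κ * ε ^ (2 - κ) := by
        rw [Real.rpow_sub hε]; norm_num; ring
  have hBpos : ∀ s, 0 ≤ s → 0 < B s := by
    intro s hs; simp only [hBdef]; positivity
  have hBle : ∀ s, 0 ≤ s → s ≤ τ → B s ≤ A1 * ε ^ (2 - κ) := by
    intro s hs hsτ
    have h1 : Real.exp (-C1 / (1 + s)) ≤ 1 := by
      rw [Real.exp_le_one_iff]
      exact div_nonpos_of_nonpos_of_nonneg (by linarith) (by linarith)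
    calc B s ≤ ε ^ 2 * A0 * (1 + s) ^ κ * 1 := by simp only [hBdef]; gcongr
      _ = A0 * (ε ^ 2 * (1 + s) ^ κ) := by ring
      _ ≤ A0 * ((1 + T) ^ κ * ε ^ (2 - κ)) := mul_le_mul_of_nonneg_left (hρk s hs hsτ) hA0p.le
      _ = _ := by rw [hA1]; ring
  have hεp : ε ^ (2 - κ) ≤ ε := by
    calc ε ^ (2 - κ) ≤ ε ^ (1 : ℝ) :=
          Real.rpow_le_rpow_of_exponent_ge hε hε1 (by linarith)
      _ = ε := Real.rpow_one ε
  have hBsmall : ∀ s, 0 ≤ s → s ≤ τ → B s ≤ 1 ∧ 4 * Λ * B s ≤ 1 := by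
    intro s hs hsτ
    have h1 : B s ≤ A1 * ε := (hBle s hs hsτ).trans (by gcongr)
    have h2 : 4 * Λ * B s ≤ 4 * Λ * (A1 * ε) := by gcongr
    have h3 : 0 ≤ ε * A1 := by positivity
    have h4 : 0 ≤ ε * A1 * Λ := by positivity
    constructor <;> nlinarith
  -- derivative of the barrier
  have hBder : ∀ s, 0 ≤ s → HasDerivAt B (B s * (κ / (1 + s) + C1 / (1 + s) ^ 2)) s := by
    intro s hs
    have hs1 : (1 + s) ≠ 0 := by positivity
    have h0 : HasDerivAt (fun s : ℝ => 1 + s) 1 s := (hasDerivAt_id s).const_add 1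
    have h1 := h0.rpow_const (p := κ) (Or.inl hs1)
    have h2 := ((hasDerivAt_const s (-C1)).div h0 hs1).exp
    have h3 := (h1.const_mul (ε ^ 2 * A0)).mul h2
    refine h3.congr_deriv ?_
    simp only [hBdef, Pi.div_apply]
    rw [Real.rpow_sub (by positivity), Real.rpow_one]
    field_simp
    ring
  set Q : ℝ → ℝ := fun s => C1 * B s / (1 + s) ^ 2 + C2 * ε ^ 2 * (1 + s) ^ (κ - 1) with hQ
  have hQle : ∀ s, 0 ≤ s → Q s ≤ B s * (κ / (1 + s) + C1 / (1 + s) ^ 2) := by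
    intro s hs
    have h1 : C2 * ε ^ 2 * (1 + s) ^ (κ - 1) ≤ B s * (κ / (1 + s)) := by
      have h2 : Real.exp (-C1) ≤ Real.exp (-C1 / (1 + s)) := by
        rw [Real.exp_le_exp, neg_div, neg_le_neg_iff]
        exact div_le_self hC1.le (by linarith)
      calc C2 * ε ^ 2 * (1 + s) ^ (κ - 1)
          = ε ^ 2 * A0 * (1 + s) ^ κ * Real.exp (-C1) * (κ / (1 + s)) := by
            rw [Real.rpow_sub (by positivity), Real.rpow_one, hA0, Real.exp_neg]
            field_simp
        _ ≤ _ := by simp only [hBdef]; gcongr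
    simp only [hQ]
    have : C1 * B s / (1 + s) ^ 2 = B s * (C1 / (1 + s) ^ 2) := by ring
    rw [this]; linarith
  -- the difference functions
  set u : ℝ → E := fun s => θ1 s - θ s with hu
  set ζ : ℝ → E := fun s => (y1 s - s • θ1 s) - (y s - s • θ s) with hζ
  have hud : ∀ s, HasDerivAt u
      ((g (y1 s) (θ1 s) - ε ^ 2 • W (y1 s)) - g (y s) (θ s)) s := by
    intro s
    have := (hS1 s).2.sub (hS s).2
    refine this.congr_deriv ?_
    simp
  have hζd : ∀ s, HasDerivAt ζ
      ((f (y1 s) (θ1 s) - s • (g (y1 s) (θ1 s) - ε ^ 2 • W (y1 s)))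
        - (f (y s) (θ s) - s • g (y s) (θ s))) s := by
    intro s
    have h1 := ((hS1 s).1.sub ((hasDerivAt_id s).smul (hS1 s).2)).sub
      ((hS s).1.sub ((hasDerivAt_id s).smul (hS s).2))
    refine h1.congr_deriv ?_
    simp only [id, Pi.smul_apply, one_smul, Pi.zero_apply, sub_zero]
    abel
  have hu0 : u 0 = 0 := by simp [hu, hθ0]
  have hζ0 : ζ 0 = 0 := by simp [hζ, hy0]
  have hcu : Continuous u := continuous_iff_continuousAt.2 fun s => (hud s).continuousAt
  have hcζ : Continuous ζ := continuous_iff_continuousAt.2 fun s => (hζd s).continuousAt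
  have hbound : ∀ s, 0 ≤ s → s ≤ τ → ‖u s‖ ≤ B s → ‖ζ s‖ ≤ (1 + s) * B s →
      ‖(g (y1 s) (θ1 s) - ε ^ 2 • W (y1 s)) - g (y s) (θ s)‖ ≤ Q s ∧
      ‖((f (y1 s) (θ1 s) - s • (g (y1 s) (θ1 s) - ε ^ 2 • W (y1 s)))
        - (f (y s) (θ s) - s • g (y s) (θ s)))‖ ≤ (1 + s) * Q s := by
    intro s hs hsτ h1 h2
    exact hpt ε (B s) s (y s) (θ s) (y1 s) (θ1 s) hs (hBpos s hs).le (hBsmall s hs hsτ).1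
      (hBsmall s hs hsτ).2 (hθM s hs) (hyΛ s hs) h1 h2
  -- continuous versions of the barrier on the half line
  have hmain : ∀ s ∈ Set.Icc 0 τ, ‖u s‖ < B |s| ∧ ‖ζ s‖ < (1 + |s|) * B |s| := by
    apply bootstrap
    · have hBc : Continuous fun s : ℝ => B |s| := by
        have h1 : ∀ s : ℝ, 1 + |s| ≠ 0 := fun s => by positivity
        simp only [hBdef]
        refine Continuous.mul (Continuous.mul continuous_const
          (Continuous.rpow_const (by fun_prop) (fun s => Or.inl (h1 s)))) ?_
        exact Real.continuous_exp.comp (continuous_const.div (by fun_prop) h1)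
      exact (isOpen_lt hcu.norm hBc).inter
        (isOpen_lt hcζ.norm ((continuous_const.add continuous_abs).mul hBc))
    · intro s hs hprev
      have hs0 := hs.1
      have hprev' : ∀ v ∈ Set.Ico 0 s, ‖u v‖ ≤ B v ∧ ‖ζ v‖ ≤ (1 + v) * B v := by
        intro v hv
        have := hprev v hv
        rw [abs_of_nonneg hv.1] at this
        exact ⟨this.1.le, this.2.le⟩
      rw [abs_of_nonneg hs0]
      constructor
      · have := image_norm_le_of_norm_deriv_right_le_deriv_boundary' (f := u) (a := 0) (b := s)
          (B := fun v => B v - B 0) (B' := fun v => B v * (κ / (1 + v) + C1 / (1 + v) ^ 2))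
          hcu.continuousOn (fun v _ => (hud v).hasDerivWithinAt) (by simp [hu0])
          (fun v hv => ((hBder v hv.1).sub_const (B 0)).continuousAt.continuousWithinAt)
          (fun v hv => ((hBder v hv.1).sub_const (B 0)).hasDerivWithinAt)
          (fun v hv => (hbound v hv.1 (hv.2.le.trans hs.2) (hprev' v hv).1 (hprev' v hv).2).1.trans
            (hQle v hv.1)) (Set.right_mem_Icc.2 hs0)
        have h0 := hBpos 0 le_rfl
        linarith
      · have hd : ∀ v, 0 ≤ v → HasDerivAt (fun v => (1 + v) * B v - B 0)
            (1 * B v + (1 + v) * (B v * (κ / (1 + v) + C1 / (1 + v) ^ 2))) v := fun v hv =>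
          (((hasDerivAt_id v).const_add 1).mul (hBder v hv)).sub_const (B 0)
        have := image_norm_le_of_norm_deriv_right_le_deriv_boundary' (f := ζ) (a := 0) (b := s)
          (B := fun v => (1 + v) * B v - B 0)
          (B' := fun v => 1 * B v + (1 + v) * (B v * (κ / (1 + v) + C1 / (1 + v) ^ 2)))
          hcζ.continuousOn (fun v _ => (hζd v).hasDerivWithinAt) (by simp [hζ0])
          (fun v hv => (hd v hv.1).continuousAt.continuousWithinAt)
          (fun v hv => (hd v hv.1).hasDerivWithinAt)
          (fun v hv => by
            have h1 := (hbound v hv.1 (hv.2.le.trans hs.2) (hprev' v hv).1 (hprev' v hv).2).2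
            have h2 := mul_le_mul_of_nonneg_left (hQle v hv.1)
              (by linarith [hv.1] : (0:ℝ) ≤ 1 + v)
            have h3 := hBpos v hv.1
            linarith) (Set.right_mem_Icc.2 hs0)
        have h0 := hBpos 0 le_rfl
        linarith
  have hmain' : ∀ s, 0 ≤ s → s ≤ τ → ‖u s‖ ≤ B s ∧ ‖ζ s‖ ≤ (1 + s) * B s := by
    intro s hs hsτ
    have := hmain s ⟨hs, hsτ⟩
    rw [abs_of_nonneg hs] at this
    exact ⟨this.1.le, this.2.le⟩
  have hep : 0 ≤ ε ^ (2 - κ) := by positivity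
  have hTk : 0 ≤ (1 + T) ^ κ := by positivity
  constructor
  · calc ‖u τ‖ ≤ B τ := (hmain' τ hτ0 le_rfl).1
      _ ≤ A1 * ε ^ (2 - κ) := hBle τ hτ0 le_rfl
      _ ≤ A * ε ^ (2 - κ) := by
        gcongr
        rw [hA]
        have : 0 ≤ C1 * A1 + C2 * (1 + T) ^ κ := by positivity
        linarith
  · have hζ' : ∀ s ∈ Set.Ico 0 τ, ‖((f (y1 s) (θ1 s) - s • (g (y1 s) (θ1 s) - ε ^ 2 • W (y1 s)))
        - (f (y s) (θ s) - s • g (y s) (θ s)))‖ ≤ A * ε ^ (2 - κ) := by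
      intro s hs
      refine (hbound s hs.1 hs.2.le (hmain' s hs.1 hs.2.le).1 (hmain' s hs.1 hs.2.le).2).2.trans ?_
      have hs1 : 0 < 1 + s := by linarith [hs.1]
      have h1 : (1 + s) * Q s = C1 * (B s / (1 + s)) + C2 * (ε ^ 2 * (1 + s) ^ κ) := by
        simp only [hQ]
        rw [Real.rpow_sub hs1, Real.rpow_one]
        field_simp
      have h2 : B s / (1 + s) ≤ A1 * ε ^ (2 - κ) :=
        (div_le_self (hBpos s hs.1).le (by linarith [hs.1])).trans (hBle s hs.1 hs.2.le)
      rw [h1]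
      calc _ ≤ C1 * (A1 * ε ^ (2 - κ)) + C2 * ((1 + T) ^ κ * ε ^ (2 - κ)) := add_le_add (mul_le_mul_of_nonneg_left h2 hC1.le)
            (mul_le_mul_of_nonneg_left (hρk s hs.1 hs.2.le) hC2.le)
        _ ≤ A * ε ^ (2 - κ) := by
          rw [hA]
          have : 0 ≤ A1 * ε ^ (2 - κ) := by positivity
          nlinarith
    have := norm_image_sub_le_of_norm_deriv_le_segment' (f := ζ) (a := 0) (b := τ)
      (fun s _ => (hζd s).hasDerivWithinAt) hζ' τ (Set.right_mem_Icc.2 hτ0)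
    rw [hζ0, sub_zero, sub_zero] at this
    calc ‖ζ τ‖ ≤ _ := this
      _ = _ := by ring


noncomputable def bcoef {n : ℕ} (a : Fin n → Fin n → (Fin n → ℝ) → ℝ) (j l : Fin n)
    (y : Fin n → ℝ) : ℝ := (a j l y + a l j y) / 2 - if j = l then 1 else 0

noncomputable def ffn {n : ℕ} (a : Fin n → Fin n → (Fin n → ℝ) → ℝ) (y θ : Fin n → ℝ) :
    Fin n → ℝ := fun j => ∑ l, bcoef a j l y * θ l

noncomputable def ggn {n : ℕ} (a : Fin n → Fin n → (Fin n → ℝ) → ℝ) (y θ : Fin n → ℝ) :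
    Fin n → ℝ :=
  fun j => -((1 / 2) * ∑ i, ∑ l, fderiv ℝ (a i l) y (Pi.single j 1) * θ i * θ l)

noncomputable def WWn {n : ℕ} (V : (Fin n → ℝ) → ℝ) (y : Fin n → ℝ) :
    Fin n → ℝ := fun j => fderiv ℝ V y (Pi.single j 1)

lemma ffn_smul {n : ℕ} (a : Fin n → Fin n → (Fin n → ℝ) → ℝ) (y θ : Fin n → ℝ) (c : ℝ) :
    ffn a y (c • θ) = c • ffn a y θ := by
  ext j
  simp only [ffn, Pi.smul_apply, smul_eq_mul, Finset.mul_sum]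
  exact Finset.sum_congr rfl fun l _ => by ring

lemma ggn_smul {n : ℕ} (a : Fin n → Fin n → (Fin n → ℝ) → ℝ) (y θ : Fin n → ℝ) (c : ℝ) :
    ggn a y (c • θ) = c ^ 2 • ggn a y θ := by
  ext j
  simp only [ggn, Pi.smul_apply, smul_eq_mul, mul_neg, Finset.mul_sum]
  congr 1
  exact Finset.sum_congr rfl fun i _ => Finset.sum_congr rfl fun l _ => by ring

lemma kin_hasFDerivAt {n : ℕ} (a : Fin n → Fin n → (Fin n → ℝ) → ℝ)
    (ha : ∀ j l, Differentiable ℝ (a j l)) (z : (Fin n → ℝ) × (Fin n → ℝ)) :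
    ∃ L : (Fin n → ℝ) × (Fin n → ℝ) →L[ℝ] ℝ, HasFDerivAt (kin n a) L z ∧
      ∀ v w, L (v, w) = (1 / 2) * ∑ i, ∑ l, (fderiv ℝ (a i l) z.1 v * z.2 i * z.2 l
        + a i l z.1 * w i * z.2 l + a i l z.1 * z.2 i * w l) := by
  have h1 : ∀ i l, ∃ L : (Fin n → ℝ) × (Fin n → ℝ) →L[ℝ] ℝ,
      HasFDerivAt (fun z : (Fin n → ℝ) × (Fin n → ℝ) => a i l z.1 * z.2 i * z.2 l) L z ∧
      ∀ v w, L (v, w) = (fderiv ℝ (a i l) z.1 v * z.2 i * z.2 l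
        + a i l z.1 * w i * z.2 l + a i l z.1 * z.2 i * w l) := by
    intro i l
    have e1 : HasFDerivAt (fun z : (Fin n → ℝ) × (Fin n → ℝ) => a i l z.1) _ z :=
      (ha i l z.1).hasFDerivAt.comp z hasFDerivAt_fst
    have e2 : ∀ i, HasFDerivAt (fun z : (Fin n → ℝ) × (Fin n → ℝ) => z.2 i)
      ((ContinuousLinearMap.proj i : (Fin n → ℝ) →L[ℝ] ℝ).comp
        (ContinuousLinearMap.snd ℝ (Fin n → ℝ) (Fin n → ℝ))) z := fun i =>
      ((ContinuousLinearMap.proj i : (Fin n → ℝ) →L[ℝ] ℝ).comp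
        (ContinuousLinearMap.snd ℝ (Fin n → ℝ) (Fin n → ℝ))).hasFDerivAt
    refine ⟨_, (e1.mul (e2 i)).mul (e2 l), ?_⟩
    intro v w
    simp
    ring
  choose L hL hL2 using h1
  refine ⟨(1 / 2 : ℝ) • ∑ i, ∑ l, L i l, ?_, ?_⟩
  · unfold kin
    exact (HasFDerivAt.fun_sum fun i _ => HasFDerivAt.fun_sum fun l _ => hL i l).const_mul _
  · intro v w
    simp [hL2]

lemma hamVF_eq {n : ℕ} (a : Fin n → Fin n → (Fin n → ℝ) → ℝ) (V : (Fin n → ℝ) → ℝ)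
    (ha : ∀ j l, Differentiable ℝ (a j l)) (hV : Differentiable ℝ V) (y θ : Fin n → ℝ) :
    hamVF n (fun z => kin n a z + V z.1) (y, θ) = (θ + ffn a y θ, ggn a y θ - WWn V y) := by
  obtain ⟨L, hL, hL2⟩ := kin_hasFDerivAt a ha (y, θ)
  have hV1 : HasFDerivAt (fun z : (Fin n → ℝ) × (Fin n → ℝ) => V z.1) _ (y, θ) :=
      (hV y).hasFDerivAt.comp (y, θ) hasFDerivAt_fst
  have h := (hL.add hV1).fderiv
  have h' : fderiv ℝ (fun z : (Fin n → ℝ) × (Fin n → ℝ) => kin n a z + V z.1) (y, θ) = _ := h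
  unfold hamVF
  rw [h']
  refine Prod.ext ?_ ?_
  · ext j
    simp only [_root_.add_apply, hL2]
    simp [ffn, bcoef, Pi.single_apply, Finset.sum_add_distrib, sub_mul]
    rw [mul_add, Finset.mul_sum, Finset.mul_sum, ← Finset.sum_add_distrib]
    exact Finset.sum_congr rfl fun l _ => by ring
  · ext j
    simp only [_root_.add_apply, hL2]
    simp [ggn, WWn]
    ring

lemma ham_conserved {n : ℕ} (p : (Fin n → ℝ) × (Fin n → ℝ) → ℝ)
    (hp : Differentiable ℝ p) (γ : ℝ → (Fin n → ℝ) × (Fin n → ℝ))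
    (hγ : ∀ t, HasDerivAt γ (hamVF n p (γ t)) t) (t : ℝ) : p (γ t) = p (γ 0) := by
  have hd : ∀ t, HasDerivAt (fun s => p (γ s)) 0 t := by
    intro t
    have := (hp (γ t)).hasFDerivAt.comp_hasDerivAt t (hγ t)
    refine this.congr_deriv ?_
    set L := fderiv ℝ p (γ t) with hLdef
    have hdec : ∀ v w : Fin n → ℝ, L (v, w)
        = ∑ j, v j * L (Pi.single j 1, 0) + ∑ j, w j * L (0, Pi.single j 1) := by
      intro v w
      have h1 : L (v, w) = L.comp (ContinuousLinearMap.inl ℝ _ _) v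
          + L.comp (ContinuousLinearMap.inr ℝ _ _) w := by
        simp only [ContinuousLinearMap.comp_apply, ContinuousLinearMap.inl_apply,
          ContinuousLinearMap.inr_apply, ← map_add]
        simp
      have h2 : ∀ (L' : (Fin n → ℝ) →L[ℝ] ℝ) (v : Fin n → ℝ),
          L' v = ∑ i, v i • L' (fun j => if i = j then (1:ℝ) else 0) := fun L' v =>
        LinearMap.pi_apply_eq_sum_univ (L' : (Fin n → ℝ) →ₗ[ℝ] ℝ) v
      rw [h1, h2, h2]
      have hs : ∀ i : Fin n, (fun j => if i = j then (1:ℝ) else 0) = Pi.single i 1 := by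
        intro i; ext j; simp [Pi.single_apply, eq_comm]
      simp [hs]
    unfold hamVF
    rw [← hLdef, hdec, ← Finset.sum_add_distrib]
    exact Finset.sum_eq_zero fun j _ => by ring
  exact is_const_of_deriv_eq_zero (fun t => (hd t).differentiableAt) (fun t => (hd t).deriv) t 0

lemma sol_iff {n : ℕ} (a : Fin n → Fin n → (Fin n → ℝ) → ℝ) (V : (Fin n → ℝ) → ℝ)
    (ha : ∀ j l, Differentiable ℝ (a j l)) (hV : Differentiable ℝ V) (y θ : ℝ → Fin n → ℝ) :
    Sol (ffn a) (ggn a) (WWn V) y θ ↔ ∀ t : ℝ, HasDerivAt (fun s => (y s, θ s))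
        (hamVF n (fun z => kin n a z + V z.1) (y t, θ t)) t := by
  constructor
  · intro h t
    rw [hamVF_eq a V ha hV]
    exact (h t).1.prodMk (h t).2
  · intro h t
    have := h t
    rw [hamVF_eq a V ha hV] at this
    exact ⟨this.fst, this.snd⟩

lemma kin_differentiable {n : ℕ} (a : Fin n → Fin n → (Fin n → ℝ) → ℝ)
    (ha : ∀ j l, Differentiable ℝ (a j l)) : Differentiable ℝ (kin n a) := fun z => by
  obtain ⟨L, hL, -⟩ := kin_hasFDerivAt a ha z
  exact hL.differentiableAt

lemma sol_conserved {n : ℕ} (a : Fin n → Fin n → (Fin n → ℝ) → ℝ) (V : (Fin n → ℝ) → ℝ)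
    (ha : ∀ j l, Differentiable ℝ (a j l)) (hV : Differentiable ℝ V) (y θ : ℝ → Fin n → ℝ)
    (h : Sol (ffn a) (ggn a) (WWn V) y θ) (t : ℝ) :
    kin n a (y t, θ t) + V (y t) = kin n a (y 0, θ 0) + V (y 0) :=
  ham_conserved (fun z => kin n a z + V z.1)
    ((kin_differentiable a ha).add (hV.comp differentiable_fst)) (fun s => (y s, θ s))
    ((sol_iff a V ha hV y θ).1 h) t

lemma WWn_zero {n : ℕ} : WWn (fun _ : Fin n → ℝ => (0:ℝ)) = 0 := by
  ext y j; simp [WWn]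

structure Coef {n : ℕ} (a : Fin n → Fin n → (Fin n → ℝ) → ℝ) (V : (Fin n → ℝ) → ℝ)
    (κ C : ℝ) : Prop where
  hC : 0 ≤ C
  da : ∀ j l, Differentiable ℝ (a j l)
  dda : ∀ j l, Differentiable ℝ (fderiv ℝ (a j l))
  dV : Differentiable ℝ V
  a0 : ∀ j l x, |a j l x - if j = l then 1 else 0| ≤ C / (1 + ‖x‖)
  a1 : ∀ j l x, ‖fderiv ℝ (a j l) x‖ ≤ C / (1 + ‖x‖) ^ 2
  a2 : ∀ j l x, ‖fderiv ℝ (fderiv ℝ (a j l)) x‖ ≤ C / (1 + ‖x‖) ^ 3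
  V0 : ∀ x, |V x| ≤ C * (1 + ‖x‖)
  V1 : ∀ x, ‖fderiv ℝ V x‖ ≤ C * (1 + ‖x‖) ^ (κ - 1)

lemma jap_bound (s μ : ℝ) (hs : 0 ≤ s) (hμ1 : 1 < μ) (m : ℕ) (hm : m ≤ 2) :
    Real.sqrt (1 + s ^ 2) ^ (-μ - m) ≤ 8 / (1 + s) ^ (m + 1) := by
  have h1 : 1 ≤ Real.sqrt (1 + s ^ 2) := by
    rw [Real.one_le_sqrt]; nlinarith
  have h2 : 1 + s ≤ 2 * Real.sqrt (1 + s ^ 2) := by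
    have : s ≤ Real.sqrt (1 + s ^ 2) := Real.le_sqrt_of_sq_le (by linarith)
    linarith
  set J := Real.sqrt (1 + s ^ 2)
  calc J ^ (-μ - m) ≤ J ^ (-((m + 1 : ℕ) : ℝ)) :=
        Real.rpow_le_rpow_of_exponent_le h1 (by push_cast; linarith)
    _ = 1 / J ^ (m + 1) := by rw [Real.rpow_neg (by linarith), Real.rpow_natCast, one_div]
    _ ≤ 8 / (1 + s) ^ (m + 1) := by
      rw [div_le_div_iff₀ (by positivity) (by positivity), one_mul]
      calc (1 + s) ^ (m + 1) ≤ (2 * J) ^ (m + 1) := by gcongr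
        _ = 2 ^ (m + 1) * J ^ (m + 1) := mul_pow _ _ _
        _ ≤ 8 * J ^ (m + 1) := by
          gcongr
          calc (2:ℝ) ^ (m + 1) ≤ 2 ^ 3 := by gcongr <;> [norm_num; omega]
            _ = 8 := by norm_num

lemma coef_of_assumption {n : ℕ} (μ : ℝ) (hμ1 : 1 < μ) (hμ2 : μ < 2)
    (a : Fin n → Fin n → (Fin n → ℝ) → ℝ) (V : (Fin n → ℝ) → ℝ)
    (ha_smooth : ∀ j l, ContDiff ℝ (⊤ : ℕ∞) (a j l)) (hV_smooth : ContDiff ℝ (⊤ : ℕ∞) V)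
    (C : ℕ → ℝ)
    (ha : ∀ (j l : Fin n) (m : ℕ) (x : Fin n → ℝ),
      ‖iteratedFDeriv ℝ m (fun y => a j l y - if j = l then 1 else 0) x‖
        ≤ C m * Real.sqrt (1 + ‖x‖ ^ 2) ^ (-μ - m))
    (hVb : ∀ (m : ℕ) (x : Fin n → ℝ),
      ‖iteratedFDeriv ℝ m V x‖ ≤ C m * Real.sqrt (1 + ‖x‖ ^ 2) ^ (2 - μ - m)) :
    ∃ D, Coef a V (2 - μ) D := by
  have hCm : ∀ m, 0 ≤ C m := by
    intro m
    have h := (norm_nonneg _).trans (hVb m 0)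
    have h2 : 0 < Real.sqrt (1 + ‖(0 : Fin n → ℝ)‖ ^ 2) ^ (2 - μ - m) := by positivity
    exact nonneg_of_mul_nonneg_left h h2
  have h0 := hCm 0
  have h1 := hCm 1
  have h2 := hCm 2
  set D := 8 * (C 0 + C 1 + C 2) with hD
  have key : ∀ m ≤ 2, C m * 8 ≤ D := by
    intro m hm
    interval_cases m <;> rw [hD] <;> linarith
  have key2 : ∀ (m : ℕ) (x : Fin n → ℝ), m ≤ 2 →
      C m * Real.sqrt (1 + ‖x‖ ^ 2) ^ (-μ - m) ≤ D / (1 + ‖x‖) ^ (m + 1) := by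
    intro m x hm
    calc _ ≤ C m * (8 / (1 + ‖x‖) ^ (m + 1)) := by
          have := jap_bound ‖x‖ μ (norm_nonneg _) hμ1 m hm
          have := hCm m
          gcongr
      _ = C m * 8 / (1 + ‖x‖) ^ (m + 1) := by ring
      _ ≤ _ := by
          have := key m hm
          gcongr
  have hJ1 : ∀ x : Fin n → ℝ, 1 ≤ Real.sqrt (1 + ‖x‖ ^ 2) := fun x => by
    rw [Real.one_le_sqrt]; nlinarith [norm_nonneg x]
  have hJ2 : ∀ x : Fin n → ℝ, 1 + ‖x‖ ≤ 2 * Real.sqrt (1 + ‖x‖ ^ 2) := fun x => by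
    have : ‖x‖ ≤ Real.sqrt (1 + ‖x‖ ^ 2) := Real.le_sqrt_of_sq_le (by linarith)
    linarith [hJ1 x]
  have hJ3 : ∀ x : Fin n → ℝ, Real.sqrt (1 + ‖x‖ ^ 2) ≤ 1 + ‖x‖ := fun x => by
    rw [Real.sqrt_le_left (by positivity)]; nlinarith [norm_nonneg x]
  have hfd : ∀ j l, fderiv ℝ (fun y => a j l y - if j = l then 1 else 0) = fderiv ℝ (a j l) := by
    intro j l; ext x; rw [fderiv_sub_const]
  refine ⟨D, by positivity, fun j l => (ha_smooth j l).differentiable (by simp),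
    fun j l => ?_, hV_smooth.differentiable (by simp), ?_, ?_, ?_, ?_, ?_⟩
  · exact ((ha_smooth j l).fderiv_right (m := 1) (by norm_cast)).differentiable (by simp)
  · intro j l x
    have := (ha j l 0 x).trans (key2 0 x (by norm_num))
    simpa [norm_iteratedFDeriv_zero] using this
  · intro j l x
    have := (ha j l 1 x).trans (key2 1 x (by norm_num))
    rw [norm_iteratedFDeriv_one, hfd] at this
    simpa using this
  · intro j l x
    have := (ha j l 2 x).trans (key2 2 x (by norm_num))
    rw [← norm_iteratedFDeriv_fderiv, norm_iteratedFDeriv_one, hfd] at this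
    exact this
  · intro x
    have := hVb 0 x
    rw [norm_iteratedFDeriv_zero, Real.norm_eq_abs] at this
    refine this.trans ?_
    have h3 : Real.sqrt (1 + ‖x‖ ^ 2) ^ (2 - μ - (0:ℕ)) ≤ 1 + ‖x‖ := by
      calc _ ≤ Real.sqrt (1 + ‖x‖ ^ 2) ^ (1 : ℝ) :=
            Real.rpow_le_rpow_of_exponent_le (hJ1 x) (by push_cast; linarith)
        _ ≤ _ := by rw [Real.rpow_one]; exact hJ3 x
    have h4 : C 0 ≤ D := by rw [hD]; linarith
    gcongr
  · intro x
    have := hVb 1 x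
    rw [norm_iteratedFDeriv_one] at this
    refine this.trans ?_
    have h3 : Real.sqrt (1 + ‖x‖ ^ 2) ^ (2 - μ - (1:ℕ)) ≤ 8 * (1 + ‖x‖) ^ (2 - μ - 1) := by
      have e : (2 - μ - ((1:ℕ):ℝ)) = 2 - μ - 1 := by norm_num
      rw [e]
      calc _ ≤ ((1 + ‖x‖) / 2) ^ (2 - μ - 1) :=
            Real.rpow_le_rpow_of_nonpos (by positivity) (by linarith [hJ2 x]) (by linarith)
        _ = (1 + ‖x‖) ^ (2 - μ - 1) * (2:ℝ) ^ (μ - 1) := by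
            rw [Real.div_rpow (by positivity) (by norm_num), div_eq_mul_inv,
              ← Real.rpow_neg (by norm_num)]
            congr 2; ring
        _ ≤ (1 + ‖x‖) ^ (2 - μ - 1) * (2:ℝ) ^ (3 : ℝ) := by
            gcongr <;> [norm_num; linarith]
        _ = _ := by norm_num; ring
    calc _ ≤ C 1 * (8 * (1 + ‖x‖) ^ (2 - μ - 1)) := by gcongr
      _ = C 1 * 8 * (1 + ‖x‖) ^ (2 - μ - 1) := by ring
      _ ≤ _ := by
        have := key 1 (by norm_num)
        gcongr

lemma abs_le_pi {n : ℕ} (x : Fin n → ℝ) (i : Fin n) : |x i| ≤ ‖x‖ := norm_le_pi_norm x i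

lemma norm_single_le {n : ℕ} (j : Fin n) : ‖(Pi.single j 1 : Fin n → ℝ)‖ ≤ 1 := by
  rw [pi_norm_le_iff_of_nonneg zero_le_one]
  intro i
  by_cases h : i = j
  · subst h; simp
  · simp [h]

lemma ffn_lip {n : ℕ} {a : Fin n → Fin n → (Fin n → ℝ) → ℝ} {V : (Fin n → ℝ) → ℝ}
    {κ C : ℝ} (h : Coef a V κ C) :
    ∀ r > 0, ∀ y y1 θ θ1 : Fin n → ℝ, (∀ z ∈ segment ℝ y y1, r ≤ 1 + ‖z‖) →
      ‖ffn a y1 θ1 - ffn a y θ‖ ≤ (n * C) * (‖θ1 - θ‖ / r + ‖y1 - y‖ * ‖θ‖ / r ^ 2) := by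
  intro r hr y y1 θ θ1 hseg
  have hC := h.hC
  rw [pi_norm_le_iff_of_nonneg (by positivity)]
  intro j
  simp only [ffn, Pi.sub_apply, ← Finset.sum_sub_distrib]
  have hterm : ∀ l, ‖bcoef a j l y1 * θ1 l - bcoef a j l y * θ l‖
      ≤ C * (‖θ1 - θ‖ / r + ‖y1 - y‖ * ‖θ‖ / r ^ 2) := by
    intro l
    have hb : |bcoef a j l y1| ≤ C / r := by
      have h1 := h.a0 j l y1
      have h2 := h.a0 l j y1
      have hle : C / (1 + ‖y1‖) ≤ C / r := by
        have := hseg y1 (right_mem_segment ℝ y y1)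
        gcongr
      have : bcoef a j l y1 = ((a j l y1 - if j = l then 1 else 0)
          + (a l j y1 - if l = j then 1 else 0)) / 2 := by
        unfold bcoef
        by_cases hjl : j = l
        · subst hjl; simp
        · simp [hjl, Ne.symm hjl]
      rw [this]
      rw [abs_le] at h1 h2 ⊢
      constructor <;> linarith
    have hd : ∀ i k, |a i k y1 - a i k y| ≤ C / r ^ 2 * ‖y1 - y‖ := by
      intro i k
      refine (convex_segment y y1).norm_image_sub_le_of_norm_fderiv_le (𝕜 := ℝ)
        (fun z _ => h.da i k z) (fun z hz => (h.a1 i k z).trans ?_)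
        (left_mem_segment ℝ y y1) (right_mem_segment ℝ y y1)
      have := hseg z hz
      gcongr
    have hbd : |bcoef a j l y1 - bcoef a j l y| ≤ C / r ^ 2 * ‖y1 - y‖ := by
      have h1 := hd j l
      have h2 := hd l j
      have : bcoef a j l y1 - bcoef a j l y
        = ((a j l y1 - a j l y) + (a l j y1 - a l j y)) / 2 := by unfold bcoef; ring
      rw [this]
      rw [abs_le] at h1 h2 ⊢
      constructor <;> linarith
    have e : bcoef a j l y1 * θ1 l - bcoef a j l y * θ l
      = bcoef a j l y1 * (θ1 - θ) l + (bcoef a j l y1 - bcoef a j l y) * θ l := by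
      simp only [Pi.sub_apply]; ring
    rw [e, Real.norm_eq_abs]
    refine (abs_add_le _ _).trans ?_
    rw [abs_mul, abs_mul]
    calc _ ≤ C / r * ‖θ1 - θ‖ + C / r ^ 2 * ‖y1 - y‖ * ‖θ‖ := by
          gcongr
          · exact abs_le_pi _ _
          · exact abs_le_pi _ _
      _ = _ := by ring
  calc _ ≤ ∑ l : Fin n, ‖bcoef a j l y1 * θ1 l - bcoef a j l y * θ l‖ := norm_sum_le _ _
    _ ≤ ∑ l : Fin n, C * (‖θ1 - θ‖ / r + ‖y1 - y‖ * ‖θ‖ / r ^ 2) :=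
      Finset.sum_le_sum fun l _ => hterm l
    _ = _ := by simp; ring

lemma ggn_lip {n : ℕ} {a : Fin n → Fin n → (Fin n → ℝ) → ℝ} {V : (Fin n → ℝ) → ℝ}
    {κ C : ℝ} (h : Coef a V κ C) :
    ∀ r > 0, ∀ y y1 θ θ1 : Fin n → ℝ, (∀ z ∈ segment ℝ y y1, r ≤ 1 + ‖z‖) →
      ‖ggn a y1 θ1 - ggn a y θ‖ ≤ (n * n * C) *
        ((‖θ1‖ + ‖θ‖) * ‖θ1 - θ‖ / r ^ 2 + ‖y1 - y‖ * ‖θ‖ ^ 2 / r ^ 3) := by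
  intro r hr y y1 θ θ1 hseg
  have hC := h.hC
  rw [pi_norm_le_iff_of_nonneg (by positivity)]
  intro j
  set S := C * ((‖θ1‖ + ‖θ‖) * ‖θ1 - θ‖ / r ^ 2 + ‖y1 - y‖ * ‖θ‖ ^ 2 / r ^ 3) with hS
  have hS0 : 0 ≤ S := by positivity
  have hterm : ∀ i l, ‖fderiv ℝ (a i l) y1 (Pi.single j 1) * θ1 i * θ1 l
      - fderiv ℝ (a i l) y (Pi.single j 1) * θ i * θ l‖ ≤ S := by
    intro i l
    have hb : |fderiv ℝ (a i l) y1 (Pi.single j 1)| ≤ C / r ^ 2 := by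
      have hle : C / (1 + ‖y1‖) ^ 2 ≤ C / r ^ 2 := by
        have := hseg y1 (right_mem_segment ℝ y y1)
        gcongr
      refine ((fderiv ℝ (a i l) y1).le_opNorm _).trans ?_
      calc _ ≤ C / (1 + ‖y1‖) ^ 2 * 1 := by
            gcongr
            · exact h.a1 i l y1
            · exact norm_single_le j
        _ ≤ _ := by linarith
    have hd : ‖fderiv ℝ (a i l) y1 - fderiv ℝ (a i l) y‖ ≤ C / r ^ 3 * ‖y1 - y‖ := by
      refine (convex_segment y y1).norm_image_sub_le_of_norm_fderiv_le (𝕜 := ℝ)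
        (fun z _ => h.dda i l z) (fun z hz => (h.a2 i l z).trans ?_)
        (left_mem_segment ℝ y y1) (right_mem_segment ℝ y y1)
      have := hseg z hz
      gcongr
    have hbd : |fderiv ℝ (a i l) y1 (Pi.single j 1) - fderiv ℝ (a i l) y (Pi.single j 1)|
        ≤ C / r ^ 3 * ‖y1 - y‖ := by
      rw [← _root_.sub_apply]
      refine ((fderiv ℝ (a i l) y1 - fderiv ℝ (a i l) y).le_opNorm _).trans ?_
      calc _ ≤ C / r ^ 3 * ‖y1 - y‖ * 1 := by
            gcongr
            exact norm_single_le j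
        _ = _ := by ring
    set d1 := fderiv ℝ (a i l) y1 (Pi.single j 1)
    set d := fderiv ℝ (a i l) y (Pi.single j 1)
    have e : d1 * θ1 i * θ1 l - d * θ i * θ l
      = d1 * (θ1 - θ) i * θ1 l + d1 * θ i * (θ1 - θ) l + (d1 - d) * θ i * θ l := by
      simp only [Pi.sub_apply]; ring
    rw [e, Real.norm_eq_abs]
    refine (abs_add_three _ _ _).trans ?_
    simp only [abs_mul]
    calc _ ≤ C / r ^ 2 * ‖θ1 - θ‖ * ‖θ1‖ + C / r ^ 2 * ‖θ‖ * ‖θ1 - θ‖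
          + C / r ^ 3 * ‖y1 - y‖ * ‖θ‖ * ‖θ‖ := by
          gcongr <;> exact abs_le_pi _ _
      _ = _ := by rw [hS]; ring
  have e : (ggn a y1 θ1 - ggn a y θ) j = -(1 / 2) * ∑ i, ∑ l,
      (fderiv ℝ (a i l) y1 (Pi.single j 1) * θ1 i * θ1 l
      - fderiv ℝ (a i l) y (Pi.single j 1) * θ i * θ l) := by
    simp only [ggn, Pi.sub_apply, Finset.sum_sub_distrib]; ring
  have hsum : ‖∑ i, ∑ l, (fderiv ℝ (a i l) y1 (Pi.single j 1) * θ1 i * θ1 l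
      - fderiv ℝ (a i l) y (Pi.single j 1) * θ i * θ l)‖ ≤ ∑ i : Fin n, ∑ l : Fin n, S :=
    (norm_sum_le _ _).trans (Finset.sum_le_sum fun i _ =>
      (norm_sum_le _ _).trans (Finset.sum_le_sum fun l _ => hterm i l))
  rw [e, norm_mul]
  calc _ ≤ 1 * ∑ i : Fin n, ∑ l : Fin n, S := by
        refine mul_le_mul ?_ hsum (norm_nonneg _) zero_le_one
        norm_num [abs_of_pos]
    _ = _ := by simp [hS]; ring

lemma WWn_bound {n : ℕ} {a : Fin n → Fin n → (Fin n → ℝ) → ℝ} {V : (Fin n → ℝ) → ℝ}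
    {κ C : ℝ} (h : Coef a V κ C) (y : Fin n → ℝ) : ‖WWn V y‖ ≤ C * (1 + ‖y‖) ^ (κ - 1) := by
  have hC := h.hC
  rw [pi_norm_le_iff_of_nonneg (by positivity)]
  intro j
  refine ((fderiv ℝ V y).le_opNorm _).trans ?_
  calc _ ≤ C * (1 + ‖y‖) ^ (κ - 1) * 1 := by
        gcongr
        · exact h.V1 y
        · exact norm_single_le j
    _ = _ := by ring

/-- all bounds in one constant -/
lemma bounds_all {n : ℕ} {a : Fin n → Fin n → (Fin n → ℝ) → ℝ} {V : (Fin n → ℝ) → ℝ}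
    {κ C : ℝ} (h : Coef a V κ C) : ∃ D > 0,
    (∀ r > 0, ∀ y y1 θ θ1 : Fin n → ℝ, (∀ z ∈ segment ℝ y y1, r ≤ 1 + ‖z‖) →
      ‖ffn a y1 θ1 - ffn a y θ‖ ≤ D * (‖θ1 - θ‖ / r + ‖y1 - y‖ * ‖θ‖ / r ^ 2)) ∧
    (∀ r > 0, ∀ y y1 θ θ1 : Fin n → ℝ, (∀ z ∈ segment ℝ y y1, r ≤ 1 + ‖z‖) →
      ‖ggn a y1 θ1 - ggn a y θ‖ ≤ D *
        ((‖θ1‖ + ‖θ‖) * ‖θ1 - θ‖ / r ^ 2 + ‖y1 - y‖ * ‖θ‖ ^ 2 / r ^ 3)) ∧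
    (∀ y, ‖WWn V y‖ ≤ D * (1 + ‖y‖) ^ (κ - 1)) ∧
    (∀ y θ, ‖ffn a y θ‖ ≤ D * ‖θ‖ / (1 + ‖y‖)) ∧
    (∀ y θ, ‖ggn a y θ‖ ≤ D * ‖θ‖ ^ 2 / (1 + ‖y‖) ^ 2) := by
  have hC := h.hC
  set D := n * C + n * n * C + C + 1 with hD
  have n1 : 0 ≤ n * C := by positivity
  have n2 : 0 ≤ n * n * C := by positivity
  have hf : ∀ r > 0, ∀ y y1 θ θ1 : Fin n → ℝ, (∀ z ∈ segment ℝ y y1, r ≤ 1 + ‖z‖) →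
      ‖ffn a y1 θ1 - ffn a y θ‖ ≤ D * (‖θ1 - θ‖ / r + ‖y1 - y‖ * ‖θ‖ / r ^ 2) := by
    intro r hr y y1 θ θ1 hs
    refine (ffn_lip h r hr y y1 θ θ1 hs).trans (mul_le_mul_of_nonneg_right ?_ (by positivity))
    linarith
  have hg : ∀ r > 0, ∀ y y1 θ θ1 : Fin n → ℝ, (∀ z ∈ segment ℝ y y1, r ≤ 1 + ‖z‖) →
      ‖ggn a y1 θ1 - ggn a y θ‖ ≤ D *
        ((‖θ1‖ + ‖θ‖) * ‖θ1 - θ‖ / r ^ 2 + ‖y1 - y‖ * ‖θ‖ ^ 2 / r ^ 3) := by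
    intro r hr y y1 θ θ1 hs
    refine (ggn_lip h r hr y y1 θ θ1 hs).trans (mul_le_mul_of_nonneg_right ?_ (by positivity))
    linarith
  refine ⟨D, by positivity, hf, hg, ?_, ?_, ?_⟩
  · intro y
    refine (WWn_bound h y).trans (mul_le_mul_of_nonneg_right ?_ (by positivity))
    linarith
  · intro y θ
    have := hf (1 + ‖y‖) (by positivity) y y 0 θ (by simp [segment_same])
    have e : ffn a y 0 = 0 := by ext j; simp [ffn]
    simpa [e, mul_div_assoc] using this
  · intro y θ
    have := hg (1 + ‖y‖) (by positivity) y y 0 θ (by simp [segment_same])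
    have e : ggn a y 0 = 0 := by ext j; simp [ggn]
    simpa [e, mul_div_assoc, sq] using this


lemma sq_norm_le_sum {n : ℕ} (x : Fin n → ℝ) : ‖x‖ ^ 2 ≤ ∑ j, x j * x j := by
  have h0 : 0 ≤ ∑ j, x j * x j := Finset.sum_nonneg fun j _ => mul_self_nonneg _
  have h1 : ‖x‖ ≤ Real.sqrt (∑ j, x j * x j) := by
    rw [pi_norm_le_iff_of_nonneg (Real.sqrt_nonneg _)]
    intro j
    rw [Real.norm_eq_abs]
    apply Real.abs_le_sqrt
    rw [sq]
    exact Finset.single_le_sum (f := fun j => x j * x j) (fun j _ => mul_self_nonneg _)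
      (Finset.mem_univ j)
  calc ‖x‖ ^ 2 ≤ Real.sqrt (∑ j, x j * x j) ^ 2 := by gcongr
    _ = _ := Real.sq_sqrt h0

lemma abs_dot_le {n : ℕ} (x v : Fin n → ℝ) : |∑ j, x j * v j| ≤ n * (‖x‖ * ‖v‖) := by
  calc |∑ j, x j * v j| ≤ ∑ j, |x j * v j| := Finset.abs_sum_le_sum_abs _ _
    _ ≤ ∑ j : Fin n, ‖x‖ * ‖v‖ := Finset.sum_le_sum fun j _ => by
      rw [abs_mul]
      exact mul_le_mul (abs_le_pi x j) (abs_le_pi v j) (abs_nonneg _) (norm_nonneg _)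
    _ = _ := by simp

lemma kin_near {n : ℕ} {a : Fin n → Fin n → (Fin n → ℝ) → ℝ} {V : (Fin n → ℝ) → ℝ}
    {κ C : ℝ} (h : Coef a V κ C) (x θ : Fin n → ℝ) :
    |kin n a (x, θ) - (1 / 2) * ∑ j, θ j * θ j| ≤ n * n * C / (1 + ‖x‖) * ‖θ‖ ^ 2 := by
  have hC := h.hC
  have e : kin n a (x, θ) - (1 / 2) * ∑ j, θ j * θ j
      = (1 / 2) * ∑ j, ∑ l, (a j l x - if j = l then 1 else 0) * θ j * θ l := by
    simp only [kin, sub_mul, Finset.sum_sub_distrib]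
    simp [mul_sub]
  have hs : |∑ j, ∑ l, (a j l x - if j = l then 1 else 0) * θ j * θ l|
      ≤ ∑ j : Fin n, ∑ l : Fin n, C / (1 + ‖x‖) * ‖θ‖ * ‖θ‖ := by
    refine (Finset.abs_sum_le_sum_abs _ _).trans (Finset.sum_le_sum fun j _ => ?_)
    refine (Finset.abs_sum_le_sum_abs _ _).trans (Finset.sum_le_sum fun l _ => ?_)
    rw [abs_mul, abs_mul]
    gcongr
    · exact h.a0 j l x
    · exact abs_le_pi _ _
    · exact abs_le_pi _ _
  rw [e, abs_mul]
  calc _ ≤ 1 * ∑ j : Fin n, ∑ l : Fin n, C / (1 + ‖x‖) * ‖θ‖ * ‖θ‖ := by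
        refine mul_le_mul ?_ hs (abs_nonneg _) zero_le_one
        norm_num [abs_of_pos]
    _ = _ := by simp; ring

lemma kin_far {n : ℕ} {a : Fin n → Fin n → (Fin n → ℝ) → ℝ} {V : (Fin n → ℝ) → ℝ}
    {κ C : ℝ} (h : Coef a V κ C) (x θ : Fin n → ℝ) (hx : 4 * (n * n * C) ≤ ‖x‖) :
    1 / 4 * ‖θ‖ ^ 2 ≤ kin n a (x, θ) := by
  have h1 := (abs_le.1 (kin_near h x θ)).1
  have h2 := sq_norm_le_sum θ
  have h3 : n * n * C / (1 + ‖x‖) ≤ 1 / 4 := by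
    rw [div_le_iff₀ (by positivity)]; linarith
  have h4 : n * n * C / (1 + ‖x‖) * ‖θ‖ ^ 2 ≤ 1 / 4 * ‖θ‖ ^ 2 := by gcongr
  linarith

lemma kin_smul {n : ℕ} (a : Fin n → Fin n → (Fin n → ℝ) → ℝ) (x θ : Fin n → ℝ) (c : ℝ) :
    kin n a (x, c • θ) = c ^ 2 * kin n a (x, θ) := by
  simp only [kin, Pi.smul_apply, smul_eq_mul, Finset.mul_sum]
  exact Finset.sum_congr rfl fun i _ => Finset.sum_congr rfl fun l _ => by ring

def NonTrap {n : ℕ} (a : Fin n → Fin n → (Fin n → ℝ) → ℝ) : Prop :=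
  ∀ x ξ : Fin n → ℝ, ξ ≠ 0 → ∃ y θ : ℝ → Fin n → ℝ, Sol (ffn a) (ggn a) 0 y θ ∧
    y 0 = x ∧ θ 0 = ξ ∧ Tendsto (fun t => ‖y t‖) atTop atTop

lemma sol0_conserved {n : ℕ} {a : Fin n → Fin n → (Fin n → ℝ) → ℝ} {V : (Fin n → ℝ) → ℝ}
    {κ C : ℝ} (h : Coef a V κ C) {y θ : ℝ → Fin n → ℝ}
    (hS : Sol (ffn a) (ggn a) 0 y θ) (t : ℝ) :
    kin n a (y t, θ t) = kin n a (y 0, θ 0) := by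
  rw [← WWn_zero] at hS
  simpa using sol_conserved a (fun _ => 0) h.da (differentiable_const 0) y θ hS t

lemma kin_ne_zero {n : ℕ} {a : Fin n → Fin n → (Fin n → ℝ) → ℝ} {V : (Fin n → ℝ) → ℝ}
    {κ C : ℝ} (h : Coef a V κ C) (hN : NonTrap a) (x ξ : Fin n → ℝ) (hξ : ξ ≠ 0) :
    kin n a (x, ξ) ≠ 0 := by
  intro h0
  obtain ⟨D, hD, -, -, -, -, hg⟩ := bounds_all h
  obtain ⟨y, θ, hS, hy0, hθ0, hlim⟩ := hN x ξ hξ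
  obtain ⟨t, htge, ht0⟩ := ((hlim.eventually_ge_atTop (4 * (n * n * C))).and
    (eventually_ge_atTop 0)).exists
  have hk : kin n a (y t, θ t) = 0 := by rw [sol0_conserved h hS t, hy0, hθ0, h0]
  have hθt : θ t = 0 := by
    have := kin_far h (y t) (θ t) htge
    rw [hk] at this
    have h2 : ‖θ t‖ ^ 2 = 0 := le_antisymm (by linarith) (sq_nonneg _)
    simpa using h2
  have hcθ : Continuous θ := continuous_iff_continuousAt.2 fun s => (hS s).2.continuousAt
  obtain ⟨M, hM⟩ := (isCompact_Icc (a := (0:ℝ)) (b := t)).exists_bound_of_continuousOn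
    hcθ.continuousOn
  have hd : ∀ s, HasDerivAt (fun s => θ (t - s)) (-(ggn a (y (t - s)) (θ (t - s)))) s := by
    intro s
    have := (hS (t - s)).2.scomp s ((hasDerivAt_id s).const_sub t)
    refine this.congr_deriv ?_
    simp
  have := norm_le_gronwallBound_of_norm_deriv_right_le (f := fun s => θ (t - s)) (δ := 0)
    (K := D * M) (ε := 0) (a := 0) (b := t)
    (hcθ.comp (continuous_const.sub continuous_id)).continuousOn
    (fun s _ => (hd s).hasDerivWithinAt) (by simp [hθt])
    (fun s hs => by
      rw [norm_neg, add_zero]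
      refine (hg _ _).trans ?_
      have h1 : ‖θ (t - s)‖ ≤ M := hM _ ⟨by linarith [hs.2], by linarith [hs.1]⟩
      calc D * ‖θ (t - s)‖ ^ 2 / (1 + ‖y (t - s)‖) ^ 2 ≤ D * ‖θ (t - s)‖ ^ 2 := by
            apply div_le_self (by positivity)
            exact one_le_pow₀ (by linarith [norm_nonneg (y (t - s))])
        _ = D * ‖θ (t - s)‖ * ‖θ (t - s)‖ := by ring
        _ ≤ D * M * ‖θ (t - s)‖ := by gcongr)
    t (Set.right_mem_Icc.2 ht0)
  rw [gronwallBound_ε0_δ0] at this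
  simp [hθ0] at this
  exact hξ this

lemma kin_pos {n : ℕ} {a : Fin n → Fin n → (Fin n → ℝ) → ℝ} {V : (Fin n → ℝ) → ℝ}
    {κ C : ℝ} (h : Coef a V κ C) (hN : NonTrap a) (x ξ : Fin n → ℝ) (hξ : ξ ≠ 0) :
    0 < kin n a (x, ξ) := by
  by_contra hneg
  push Not at hneg
  have hn : 0 < ‖ξ‖ := norm_pos_iff.2 hξ
  have hC := h.hC
  set s0 := (‖x‖ + 4 * (n * n * C)) / ‖ξ‖ with hs0
  have hs00 : 0 ≤ s0 := by positivity
  have hcont : Continuous fun s : ℝ => kin n a (x + s • ξ, ξ) :=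
    (kin_differentiable a h.da).continuous.comp (by fun_prop)
  have hfar : 0 < kin n a (x + s0 • ξ, ξ) := by
    refine lt_of_lt_of_le ?_ (kin_far h _ ξ ?_)
    · positivity
    · have h1 : ‖s0 • ξ‖ ≤ ‖x + s0 • ξ‖ + ‖x‖ := by
        have := norm_sub_le (x + s0 • ξ) x; simpa using this
      rw [norm_smul, Real.norm_of_nonneg hs00, hs0, div_mul_cancel₀ _ hn.ne'] at h1
      linarith
  obtain ⟨s, -, hs⟩ := intermediate_value_Icc hs00 hcont.continuousOn
    (show (0:ℝ) ∈ Set.Icc _ _ from ⟨by simpa using hneg, hfar.le⟩)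
  exact kin_ne_zero h hN _ ξ hξ hs

lemma elliptic {n : ℕ} {a : Fin n → Fin n → (Fin n → ℝ) → ℝ} {V : (Fin n → ℝ) → ℝ}
    {κ C : ℝ} (h : Coef a V κ C) (hN : NonTrap a) :
    ∃ c > 0, ∃ Ck > 0, ∀ x θ : Fin n → ℝ,
      c * ‖θ‖ ^ 2 ≤ kin n a (x, θ) ∧ kin n a (x, θ) ≤ Ck * ‖θ‖ ^ 2 := by
  have hC := h.hC
  set R := 4 * (n * n * C) with hR
  obtain ⟨c0, hc0, hmin⟩ := ((isCompact_closedBall (0 : Fin n → ℝ) R).prod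
    (isCompact_sphere (0 : Fin n → ℝ) 1)).exists_forall_le' (a := 0)
    (kin_differentiable a h.da).continuous.continuousOn
    (fun z hz => kin_pos h hN z.1 z.2 (by
      have := hz.2
      rw [mem_sphere_zero_iff_norm] at this
      exact norm_pos_iff.1 (by rw [this]; norm_num)))
  refine ⟨min c0 (1 / 4), by positivity, n + n * n * C + 1, by positivity, fun x θ => ⟨?_, ?_⟩⟩
  · by_cases hx : R ≤ ‖x‖
    · refine le_trans ?_ (kin_far h x θ hx)
      gcongr
      exact min_le_right _ _
    · by_cases hθ : θ = 0
      · subst hθ; simp [kin]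
      · have hn : 0 < ‖θ‖ := norm_pos_iff.2 hθ
        have h1 := hmin (x, ‖θ‖⁻¹ • θ) ⟨by
          rw [mem_closedBall_zero_iff]; exact (not_le.1 hx).le, by
          rw [mem_sphere_zero_iff_norm]; exact norm_smul_inv_norm hθ⟩
        rw [kin_smul, inv_pow, ← div_eq_inv_mul, le_div_iff₀ (by positivity)] at h1
        refine le_trans ?_ h1
        gcongr
        exact min_le_left _ _
  · have h1 := (abs_le.1 (kin_near h x θ)).2
    have h2 := (abs_le.1 (abs_dot_le θ θ)).2
    have h3 : n * n * C / (1 + ‖x‖) ≤ n * n * C :=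
      div_le_self (by positivity) (by linarith [norm_nonneg x])
    have h4 : n * n * C / (1 + ‖x‖) * ‖θ‖ ^ 2 ≤ n * n * C * ‖θ‖ ^ 2 := by gcongr
    have h5 : 0 ≤ n * (‖θ‖ * ‖θ‖) := by positivity
    nlinarith [sq_nonneg ‖θ‖]

lemma sol0_norm {n : ℕ} {a : Fin n → Fin n → (Fin n → ℝ) → ℝ} {V : (Fin n → ℝ) → ℝ}
    {κ C : ℝ} (h : Coef a V κ C) (hN : NonTrap a) :
    ∃ m > 0, ∃ M > 0, ∀ y θ : ℝ → Fin n → ℝ, Sol (ffn a) (ggn a) 0 y θ → ‖θ 0‖ = 1 →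
      ∀ t, m ≤ ‖θ t‖ ^ 2 ∧ ‖θ t‖ ≤ M := by
  obtain ⟨c, hc, Ck, hCk, hell⟩ := elliptic h hN
  refine ⟨c / Ck, by positivity, Real.sqrt (Ck / c), by positivity, ?_⟩
  intro y θ hS hθ t
  have h1 := hell (y t) (θ t)
  have h2 := hell (y 0) (θ 0)
  rw [sol0_conserved h hS t] at h1
  rw [hθ] at h2
  constructor
  · rw [div_le_iff₀ hCk]; nlinarith
  · apply Real.le_sqrt_of_sq_le
    rw [le_div_iff₀ hc]; nlinarith


lemma growth_of_deriv {F F' : ℝ → ℝ} {c a b : ℝ} (hab : a ≤ b)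
    (hF : ∀ s, HasDerivAt F (F' s) s) (hb : ∀ s, a < s → s < b → c ≤ F' s) :
    c * (b - a) ≤ F b - F a := by
  refine (convex_Icc a b).mul_sub_le_image_sub_of_le_deriv
    (fun s _ => (hF s).continuousAt.continuousWithinAt)
    (fun s _ => (hF s).differentiableAt.differentiableWithinAt) ?_ a (Set.left_mem_Icc.2 hab) b
    (Set.right_mem_Icc.2 hab) hab
  intro s hs
  rw [interior_Icc] at hs
  rw [(hF s).deriv]
  exact hb s hs.1 hs.2

lemma hasDerivAt_dot {n : ℕ} {x v : ℝ → Fin n → ℝ} {x' v' : Fin n → ℝ} {t : ℝ}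
    (hx : HasDerivAt x x' t) (hv : HasDerivAt v v' t) :
    HasDerivAt (fun s => ∑ j, x s j * v s j) (∑ j, x' j * v t j + ∑ j, x t j * v' j) t := by
  rw [← Finset.sum_add_distrib]
  exact HasDerivAt.fun_sum fun j _ => ((hasDerivAt_pi.1 hx j).mul (hasDerivAt_pi.1 hv j))

/-- virial constants -/
lemma virial {n : ℕ} {a : Fin n → Fin n → (Fin n → ℝ) → ℝ} {V : (Fin n → ℝ) → ℝ}
    {κ C : ℝ} (h : Coef a V κ C) :
    ∃ R > 0, ∃ D > 0, ∀ y θ : Fin n → ℝ,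
      (R ≤ ‖y‖ → 1 / 2 * ‖θ‖ ^ 2 ≤ ∑ j, (θ + ffn a y θ) j * θ j + ∑ j, y j * ggn a y θ j) ∧
      2 * (∑ j, y j * θ j) - D * ‖θ‖ ≤
        ∑ j, (θ + ffn a y θ) j * y j + ∑ j, y j * (θ + ffn a y θ) j := by
  obtain ⟨D, hD, -, -, -, hf, hg⟩ := bounds_all h
  refine ⟨4 * (n * D) + 1, by positivity, 2 * (n * D) + 1, by positivity, fun y θ => ⟨?_, ?_⟩⟩
  · intro hR
    have e : ∑ j, (θ + ffn a y θ) j * θ j = ∑ j, θ j * θ j + ∑ j, ffn a y θ j * θ j := by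
      rw [← Finset.sum_add_distrib]
      exact Finset.sum_congr rfl fun j _ => by simp only [Pi.add_apply]; ring
    have h1 := sq_norm_le_sum θ
    have h2 := (abs_le.1 (abs_dot_le (ffn a y θ) θ)).1
    have h3 := (abs_le.1 (abs_dot_le y (ggn a y θ))).1
    have hy : 0 < 1 + ‖y‖ := by positivity
    have hs : n * D / (1 + ‖y‖) ≤ 1 / 4 := by
      rw [div_le_iff₀ hy]; linarith
    have h4 : n * (‖ffn a y θ‖ * ‖θ‖) ≤ 1 / 4 * ‖θ‖ ^ 2 := by
      calc _ ≤ n * (D * ‖θ‖ / (1 + ‖y‖) * ‖θ‖) := by gcongr; exact hf y θ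
        _ = n * D / (1 + ‖y‖) * ‖θ‖ ^ 2 := by ring
        _ ≤ _ := by gcongr
    have h5 : n * (‖y‖ * ‖ggn a y θ‖) ≤ 1 / 4 * ‖θ‖ ^ 2 := by
      calc _ ≤ n * ((1 + ‖y‖) * (D * ‖θ‖ ^ 2 / (1 + ‖y‖) ^ 2)) := by
            gcongr
            · linarith
            · exact hg y θ
        _ = n * D / (1 + ‖y‖) * ‖θ‖ ^ 2 := by field_simp
        _ ≤ _ := by gcongr
    rw [e]; linarith
  · have e : ∑ j, (θ + ffn a y θ) j * y j + ∑ j, y j * (θ + ffn a y θ) j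
        = 2 * (∑ j, y j * θ j) + 2 * ∑ j, y j * ffn a y θ j := by
      rw [Finset.mul_sum, Finset.mul_sum, ← Finset.sum_add_distrib, ← Finset.sum_add_distrib]
      exact Finset.sum_congr rfl fun j _ => by simp only [Pi.add_apply]; ring
    have h2 := (abs_le.1 (abs_dot_le y (ffn a y θ))).1
    have h4 : n * (‖y‖ * ‖ffn a y θ‖) ≤ n * D * ‖θ‖ := by
      calc _ ≤ n * ((1 + ‖y‖) * (D * ‖θ‖ / (1 + ‖y‖))) := by
            gcongr
            · linarith
            · exact hf y θ
        _ = n * D * ‖θ‖ := by field_simp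
    rw [e]
    nlinarith [norm_nonneg θ]

/-- Constants for the outgoing region and its consequences. -/
lemma outgoing {n : ℕ} {a : Fin n → Fin n → (Fin n → ℝ) → ℝ} {V : (Fin n → ℝ) → ℝ}
    {κ C : ℝ} (h : Coef a V κ C) (hN : NonTrap a) :
    ∃ G0 h0 N : ℝ, 0 < N ∧
      (∀ y θ : ℝ → Fin n → ℝ, Sol (ffn a) (ggn a) 0 y θ → ‖θ 0‖ = 1 →
        ∀ t0, G0 < ∑ j, y t0 j * y t0 j → h0 < ∑ j, y t0 j * θ t0 j →
          ∀ t ≥ t0, t - t0 ≤ N * ‖y t‖) ∧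
      (∀ y θ : ℝ → Fin n → ℝ, Sol (ffn a) (ggn a) 0 y θ → ‖θ 0‖ = 1 →
        Tendsto (fun t => ‖y t‖) atTop atTop →
          ∃ t0 ≥ 0, G0 < ∑ j, y t0 j * y t0 j ∧ h0 < ∑ j, y t0 j * θ t0 j) := by
  obtain ⟨R, hR, D, hD, hvir⟩ := virial h
  obtain ⟨m, hm, M, hM, hbd⟩ := sol0_norm h hN
  have hHd : ∀ y θ : ℝ → Fin n → ℝ, Sol (ffn a) (ggn a) 0 y θ → ∀ t,
      HasDerivAt (fun s => ∑ j, y s j * θ s j)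
        (∑ j, (θ t + ffn a (y t) (θ t)) j * θ t j + ∑ j, y t j * ggn a (y t) (θ t) j) t := by
    intro y θ hS t
    refine (hasDerivAt_dot (hS t).1 (hS t).2).congr_deriv ?_
    simp
  have hGd : ∀ y θ : ℝ → Fin n → ℝ, Sol (ffn a) (ggn a) 0 y θ → ∀ t,
      HasDerivAt (fun s => ∑ j, y s j * y s j)
        (∑ j, (θ t + ffn a (y t) (θ t)) j * y t j
          + ∑ j, y t j * (θ t + ffn a (y t) (θ t)) j) t := by
    intro y θ hS t
    exact hasDerivAt_dot (hS t).1 (hS t).1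
  refine ⟨(n + 1) * R ^ 2, D * M, (n * M + 1) * (2 / m), by positivity, ?_, ?_⟩
  · intro y θ hS hθ t0 hG hH t ht
    have hcG : Continuous fun s => ∑ j, y s j * y s j :=
      continuous_iff_continuousAt.2 fun s => (hGd y θ hS s).continuousAt
    have hcH : Continuous fun s => ∑ j, y s j * θ s j :=
      continuous_iff_continuousAt.2 fun s => (hHd y θ hS s).continuousAt
    have hHder : ∀ s, (n + 1) * R ^ 2 < ∑ j, y s j * y s j →
        m / 2 ≤ ∑ j, (θ s + ffn a (y s) (θ s)) j * θ s j
          + ∑ j, y s j * ggn a (y s) (θ s) j := by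
      intro s hs
      have hRy : R ≤ ‖y s‖ := by
        by_contra hlt
        push Not at hlt
        have h1 := (abs_le.1 (abs_dot_le (y s) (y s))).2
        have h2 : ‖y s‖ * ‖y s‖ ≤ R ^ 2 := by nlinarith [norm_nonneg (y s)]
        have h3 : n * (‖y s‖ * ‖y s‖) ≤ n * R ^ 2 := by gcongr
        nlinarith
      have := (hvir (y s) (θ s)).1 hRy
      have := (hbd y θ hS hθ s).1
      linarith
    have key : ∀ s ∈ Set.Icc t0 t, (n + 1) * R ^ 2 < ∑ j, y s j * y s j ∧
        D * M < ∑ j, y s j * θ s j := by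
      apply bootstrap
      · exact (isOpen_lt continuous_const hcG).inter (isOpen_lt continuous_const hcH)
      · intro s hs hprev
        constructor
        · have := growth_of_deriv (c := 0) hs.1 (hGd y θ hS) (fun v hv1 hv2 => by
            have h1 := (hprev v ⟨hv1.le, hv2⟩).2
            have h2 := (hvir (y v) (θ v)).2
            have h3 : D * ‖θ v‖ ≤ D * M := by gcongr; exact (hbd y θ hS hθ v).2
            have h4 : 0 ≤ D * M := by positivity
            linarith)
          linarith
        · have := growth_of_deriv (c := m / 2) hs.1 (hHd y θ hS) (fun v hv1 hv2 =>
            hHder v (hprev v ⟨hv1.le, hv2⟩).1)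
          have h2 : 0 ≤ m / 2 * (s - t0) := mul_nonneg (by positivity) (by linarith [hs.1])
          linarith
    have h1 := growth_of_deriv (c := m / 2) ht (hHd y θ hS) (fun v hv1 hv2 =>
            hHder v (key v ⟨hv1.le, hv2.le⟩).1)
    have h2 := (abs_le.1 (abs_dot_le (y t) (θ t))).2
    have h3 : n * (‖y t‖ * ‖θ t‖) ≤ n * (‖y t‖ * M) := by
      gcongr; exact (hbd y θ hS hθ t).2
    have h4 : 0 ≤ D * M := by positivity
    have h5 : m / 2 * (t - t0) ≤ (n * M + 1) * ‖y t‖ := by nlinarith [norm_nonneg (y t)]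
    calc t - t0 = 2 / m * (m / 2 * (t - t0)) := by field_simp
      _ ≤ 2 / m * ((n * M + 1) * ‖y t‖) := by gcongr
      _ = _ := by ring
  · intro y θ hS hθ hlim
    obtain ⟨t1, ht1⟩ := eventually_atTop.1 (hlim.eventually_ge_atTop (R * (n + 2)))
    set t2 := max t1 0 with ht2
    set H2 := ∑ j, y t2 j * θ t2 j with hH2
    set s := t2 + 2 / m * (|D * M - H2| + 1) with hs
    have hst : t2 ≤ s := by
      rw [hs]
      have : 0 ≤ 2 / m * (|D * M - H2| + 1) := by positivity
      linarith
    refine ⟨s, (le_max_right _ _).trans hst, ?_, ?_⟩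
    · have h1 := ht1 s ((le_max_left _ _).trans hst)
      have h2 := sq_norm_le_sum (y s)
      have h3 : (R * (n + 2)) ^ 2 ≤ ‖y s‖ ^ 2 := by gcongr
      refine lt_of_lt_of_le ?_ (h3.trans h2)
      have h4 : (0:ℝ) ≤ n := by positivity
      have h5 : 0 < R ^ 2 := by positivity
      have h6 : (n:ℝ) + 1 < (n + 2) ^ 2 := by nlinarith
      nlinarith
    · have h1 := growth_of_deriv (c := m / 2) hst (hHd y θ hS) (fun v hv1 hv2 => by
        have h1 := ht1 v ((le_max_left _ _).trans hv1.le)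
        have h3 : R ≤ ‖y v‖ := by
          have h4 : (0:ℝ) ≤ n := by positivity
          nlinarith
        have := (hvir (y v) (θ v)).1 h3
        have := (hbd y θ hS hθ v).1
        linarith)
      have h2 : m / 2 * (s - t2) = |D * M - H2| + 1 := by
        rw [hs]; field_simp; ring
      have h3 := le_abs_self (D * M - H2)
      linarith

lemma cont_dep {n : ℕ} {a : Fin n → Fin n → (Fin n → ℝ) → ℝ} {V : (Fin n → ℝ) → ℝ}
    {κ C : ℝ} (h : Coef a V κ C) (hN : NonTrap a) :
    ∃ K : ℝ, ∀ y θ y1 θ1 : ℝ → Fin n → ℝ, Sol (ffn a) (ggn a) 0 y θ → ‖θ 0‖ = 1 →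
      Sol (ffn a) (ggn a) 0 y1 θ1 → ‖θ1 0‖ = 1 → ∀ t ≥ 0,
      ‖(y1 t, θ1 t) - (y t, θ t)‖ ≤ ‖(y1 0, θ1 0) - (y 0, θ 0)‖ * Real.exp (K * t) := by
  obtain ⟨D, hD, hf, hg, -, -, -⟩ := bounds_all h
  obtain ⟨m, hm, M, hM, hbd⟩ := sol0_norm h hN
  refine ⟨1 + D * (1 + M) + D * ((M + M) + M ^ 2), ?_⟩
  intro y θ y1 θ1 hS hθ hS1 hθ1 t ht
  have hd : ∀ s, HasDerivAt (fun s => (y1 s, θ1 s) - (y s, θ s))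
      ((θ1 s + ffn a (y1 s) (θ1 s), ggn a (y1 s) (θ1 s)) - (θ s + ffn a (y s) (θ s),
        ggn a (y s) (θ s))) s := by
    intro s
    have := ((hS1 s).1.prodMk (hS1 s).2).sub ((hS s).1.prodMk (hS s).2)
    refine this.congr_deriv ?_
    simp
  have := norm_le_gronwallBound_of_norm_deriv_right_le (f := fun s => (y1 s, θ1 s) - (y s, θ s))
    (δ := ‖(y1 0, θ1 0) - (y 0, θ 0)‖)
    (K := 1 + D * (1 + M) + D * ((M + M) + M ^ 2)) (ε := 0) (a := 0) (b := t)
    (fun s _ => (hd s).continuousAt.continuousWithinAt)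
    (fun s _ => (hd s).hasDerivWithinAt) le_rfl
    (fun s hs => by
      rw [add_zero]
      set P := ‖(y1 s, θ1 s) - (y s, θ s)‖ with hP
      have hw : ‖y1 s - y s‖ ≤ P := norm_fst_le ((y1 s, θ1 s) - (y s, θ s))
      have hu : ‖θ1 s - θ s‖ ≤ P := norm_snd_le ((y1 s, θ1 s) - (y s, θ s))
      have hP0 : 0 ≤ P := norm_nonneg _
      have h1 := hf 1 one_pos (y s) (y1 s) (θ s) (θ1 s) (fun z _ => by linarith [norm_nonneg z])
      have h2 := hg 1 one_pos (y s) (y1 s) (θ s) (θ1 s) (fun z _ => by linarith [norm_nonneg z])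
      simp only [one_pow, div_one] at h1 h2
      have b0 := (hbd y θ hS hθ s).2
      have b1 := (hbd y1 θ1 hS1 hθ1 s).2
      have h1' : ‖ffn a (y1 s) (θ1 s) - ffn a (y s) (θ s)‖ ≤ D * (P + P * M) :=
        h1.trans (by gcongr)
      have h2' : ‖ggn a (y1 s) (θ1 s) - ggn a (y s) (θ s)‖
          ≤ D * ((M + M) * P + P * M ^ 2) := h2.trans (by gcongr)
      have q1 : 0 ≤ D * (P + P * M) := by positivity
      have q2 : 0 ≤ D * ((M + M) * P + P * M ^ 2) := by positivity
      have e : (1 + D * (1 + M) + D * ((M + M) + M ^ 2)) * P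
        = P + D * (P + P * M) + D * ((M + M) * P + P * M ^ 2) := by ring
      rw [e, Prod.norm_def]
      apply max_le
      · have : (θ1 s + ffn a (y1 s) (θ1 s)) - (θ s + ffn a (y s) (θ s))
          = (θ1 s - θ s) + (ffn a (y1 s) (θ1 s) - ffn a (y s) (θ s)) := by abel
        have h3 : ‖(θ1 s + ffn a (y1 s) (θ1 s)) - (θ s + ffn a (y s) (θ s))‖
          ≤ P + D * (P + P * M) := by
          rw [this]; exact (norm_add_le _ _).trans (add_le_add hu h1')
        exact h3.trans (by linarith)
      · exact h2'.trans (by linarith))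
    t (Set.right_mem_Icc.2 ht)
  rw [gronwallBound_ε0, sub_zero] at this
  exact this

lemma uniform_escape {n : ℕ} {a : Fin n → Fin n → (Fin n → ℝ) → ℝ} {V : (Fin n → ℝ) → ℝ}
    {κ C : ℝ} (h : Coef a V κ C) (hN : NonTrap a) (K : Set (Fin n → ℝ)) (hK : IsCompact K) :
    ∃ Λ > 0, ∀ y θ : ℝ → Fin n → ℝ, Sol (ffn a) (ggn a) 0 y θ → ‖θ 0‖ = 1 → y 0 ∈ K →
      ∀ t ≥ 0, 1 + t ≤ Λ * (1 + ‖y t‖) := by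
  obtain ⟨G0, h0, N, hNpos, hout, hex⟩ := outgoing h hN
  obtain ⟨Kc, hdep⟩ := cont_dep h hN
  have main : ∃ Λ > 0, ∀ y θ : ℝ → Fin n → ℝ, Sol (ffn a) (ggn a) 0 y θ → ‖θ 0‖ = 1 →
      (y 0, θ 0) ∈ K ×ˢ Metric.sphere (0 : Fin n → ℝ) 1 →
      ∀ t ≥ 0, 1 + t ≤ Λ * (1 + ‖y t‖) := by
    refine (hK.prod (isCompact_sphere (0 : Fin n → ℝ) 1)).induction_on
      (p := fun s => ∃ Λ > 0, ∀ y θ : ℝ → Fin n → ℝ, Sol (ffn a) (ggn a) 0 y θ → ‖θ 0‖ = 1 →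
      (y 0, θ 0) ∈ s → ∀ t ≥ 0, 1 + t ≤ Λ * (1 + ‖y t‖)) ?_ ?_ ?_ ?_
    · exact ⟨1, one_pos, fun y θ _ _ hf => absurd hf (Set.notMem_empty _)⟩
    · rintro s t hst ⟨Λ, hΛ, hs⟩
      exact ⟨Λ, hΛ, fun y θ h1 h2 h3 => hs y θ h1 h2 (hst h3)⟩
    · rintro s t ⟨Λ, hΛ, hs⟩ ⟨Λ', hΛ', hs'⟩
      refine ⟨Λ + Λ', by positivity, fun y θ h1 h2 h3 τ hτ => ?_⟩
      have hp : 0 < 1 + ‖y τ‖ := by positivity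
      rcases h3 with h3 | h3
      · have := hs y θ h1 h2 h3 τ hτ
        nlinarith
      · have := hs' y θ h1 h2 h3 τ hτ
        nlinarith
    · rintro ⟨x0, ω0⟩ hx
      have hω : ‖ω0‖ = 1 := by simpa using hx.2
      obtain ⟨y, θ, hS, hy0, hθ0, hlim⟩ := hN x0 ω0 (norm_pos_iff.1 (by rw [hω]; norm_num))
      have hθ1 : ‖θ 0‖ = 1 := by rw [hθ0, hω]
      obtain ⟨t0, ht0, hG, hH⟩ := hex y θ hS hθ1 hlim
      have hopen : IsOpen {z : (Fin n → ℝ) × (Fin n → ℝ) |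
          G0 < ∑ j, z.1 j * z.1 j ∧ h0 < ∑ j, z.1 j * z.2 j} := by
        have c1 : Continuous fun z : (Fin n → ℝ) × (Fin n → ℝ) => ∑ j, z.1 j * z.1 j := by fun_prop
        have c2 : Continuous fun z : (Fin n → ℝ) × (Fin n → ℝ) => ∑ j, z.1 j * z.2 j := by fun_prop
        exact (isOpen_lt continuous_const c1).inter (isOpen_lt continuous_const c2)
      obtain ⟨δ, hδ, hball⟩ := Metric.isOpen_iff.1 hopen (y t0, θ t0) ⟨hG, hH⟩
      refine ⟨Metric.ball (x0, ω0) (δ / Real.exp (Kc * t0)),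
        mem_nhdsWithin_of_mem_nhds (Metric.ball_mem_nhds _ (by positivity)),
        1 + t0 + N, by positivity, ?_⟩
      intro y1 θ1 hS1 hθ11 hmem t ht
      rw [mem_ball_iff_norm, lt_div_iff₀ (Real.exp_pos _)] at hmem
      have h1 := hdep y θ y1 θ1 hS hθ1 hS1 hθ11 t0 ht0
      rw [hy0, hθ0] at h1
      have h2 := hball (mem_ball_iff_norm.2 (lt_of_le_of_lt h1 hmem))
      have hy : 0 ≤ ‖y1 t‖ := norm_nonneg _
      by_cases htt : t0 ≤ t
      · have h3 := hout y1 θ1 hS1 hθ11 t0 h2.1 h2.2 t htt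
        nlinarith
      · push Not at htt
        have : 0 ≤ (t0 + N) * ‖y1 t‖ := by positivity
        nlinarith
  obtain ⟨Λ, hΛ, hm⟩ := main
  exact ⟨Λ, hΛ, fun y θ hS h1 h2 => hm y θ hS h1 ⟨h2, by simpa using h1⟩⟩


lemma Coef.zero {n : ℕ} {a : Fin n → Fin n → (Fin n → ℝ) → ℝ} {V : (Fin n → ℝ) → ℝ}
    {κ C : ℝ} (h : Coef a V κ C) : Coef a (fun _ => 0) κ C := by
  have hC := h.hC
  refine ⟨h.hC, h.da, h.dda, differentiable_const 0, h.a0, h.a1, h.a2, ?_, ?_⟩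
  · intro x; simp; positivity
  · intro x; simp; positivity

lemma small_regime {n : ℕ} {a : Fin n → Fin n → (Fin n → ℝ) → ℝ} {V : (Fin n → ℝ) → ℝ}
    {κ C : ℝ} (h : Coef a V κ C) (hN : NonTrap a) (hκ1 : κ < 1) (T : ℝ) (hT : 0 < T)
    (K : Set (Fin n → ℝ)) (hK : IsCompact K) (L : ℝ) :
    ∃ B > 0, ∀ y θ : ℝ → Fin n → ℝ, Sol (ffn a) (ggn a) (WWn V) y θ → y 0 ∈ K → ‖θ 0‖ ≤ L →
      ∀ t, 0 ≤ t → t ≤ T → ‖θ t‖ ≤ B ∧ ‖(y t - t • θ t) - y 0‖ ≤ B * t := by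
  have hC := h.hC
  obtain ⟨D, hD, -, -, hW, hf, hg⟩ := bounds_all h
  obtain ⟨c, hc, Ck, hCk, hell⟩ := elliptic h hN
  obtain ⟨r0, hr0⟩ := hK.isBounded.exists_norm_le
  set r := |r0| with hr
  have hrK : ∀ x ∈ K, ‖x‖ ≤ r := fun x hx => (hr0 x hx).trans (le_abs_self _)
  have hr_nonneg : 0 ≤ r := abs_nonneg _
  set P := (Ck * L ^ 2 + C * (1 + r) + C) / c with hP
  have hP0 : 0 ≤ P := by positivity
  have hgc : Continuous (gronwallBound r ((1 + D) * P) ((1 + D) * (1 + P))) :=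
    continuous_iff_continuousAt.2 fun x => (hasDerivAt_gronwallBound _ _ _ x).continuousAt
  obtain ⟨Y0, hY0⟩ := (isCompact_Icc (a := (0:ℝ)) (b := T)).exists_bound_of_continuousOn
    hgc.continuousOn
  set Yb := |Y0| with hYb
  have hYb0 : 0 ≤ Yb := abs_nonneg _
  set Tb := 1 + P + P * Yb with hTb
  have hTb0 : 0 ≤ Tb := by positivity
  set Z := D * Tb + T * (D * Tb ^ 2 + D) with hZ
  have hZ0 : 0 ≤ Z := by positivity
  refine ⟨Tb + Z + 1, by positivity, ?_⟩
  intro y θ hS hy0 hθ0 t ht htT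
  have hθb : ∀ s, ‖θ s‖ ≤ 1 + P + P * ‖y s‖ := by
    intro s
    have hcons := sol_conserved a V h.da h.dV y θ hS s
    have e1 := (hell (y s) (θ s)).1
    have e2 := (hell (y 0) (θ 0)).2
    have e3 : Ck * ‖θ 0‖ ^ 2 ≤ Ck * L ^ 2 := by gcongr
    have e4 := (abs_le.1 (h.V0 (y 0))).2
    have e5 := (abs_le.1 (h.V0 (y s))).1
    have e6 : C * (1 + ‖y 0‖) ≤ C * (1 + r) := by gcongr; exact hrK _ hy0
    have e7 : c * ‖θ s‖ ^ 2 ≤ Ck * L ^ 2 + C * (1 + r) + C * (1 + ‖y s‖) := by linarith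
    have e8 : ‖θ s‖ ^ 2 ≤ P * (1 + ‖y s‖) := by
      rw [hP, div_mul_eq_mul_div, le_div_iff₀ hc]
      have : 0 ≤ (Ck * L ^ 2 + C * (1 + r)) * ‖y s‖ := by positivity
      nlinarith
    nlinarith [sq_nonneg (‖θ s‖ - 1)]
  have hf1 : ∀ s, ‖ffn a (y s) (θ s)‖ ≤ D * ‖θ s‖ := fun s =>
    (hf _ _).trans (div_le_self (by positivity) (by linarith [norm_nonneg (y s)]))
  have hyb : ∀ s, 0 ≤ s → s ≤ T → ‖y s‖ ≤ Yb := by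
    intro s hs hsT
    have := norm_le_gronwallBound_of_norm_deriv_right_le (f := y) (δ := r)
      (K := (1 + D) * P) (ε := (1 + D) * (1 + P)) (a := 0) (b := s)
      (fun v _ => (hS v).1.continuousAt.continuousWithinAt)
      (fun v _ => (hS v).1.hasDerivWithinAt) (hrK _ hy0)
      (fun v _ => by
        calc ‖θ v + ffn a (y v) (θ v)‖ ≤ ‖θ v‖ + D * ‖θ v‖ :=
              (norm_add_le _ _).trans (by linarith [hf1 v])
          _ = (1 + D) * ‖θ v‖ := by ring
          _ ≤ (1 + D) * (1 + P + P * ‖y v‖) := by gcongr; exact hθb v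
          _ = _ := by ring) s (Set.right_mem_Icc.2 hs)
    rw [sub_zero] at this
    exact this.trans ((le_abs_self _).trans ((hY0 s ⟨hs, hsT⟩).trans (le_abs_self _)))
  have hθT : ∀ s, 0 ≤ s → s ≤ T → ‖θ s‖ ≤ Tb := by
    intro s hs hsT
    refine (hθb s).trans ?_
    rw [hTb]
    have := hyb s hs hsT
    gcongr
  constructor
  · exact (hθT t ht htT).trans (by linarith)
  · have hζd : ∀ s, HasDerivAt (fun s => y s - s • θ s)
      (ffn a (y s) (θ s) - s • (ggn a (y s) (θ s) - WWn V (y s))) s := by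
      intro s
      have h1 := ((hS s).1.sub ((hasDerivAt_id s).smul (hS s).2))
      refine h1.congr_deriv ?_
      simp only [id, one_smul]
      abel
    have := norm_image_sub_le_of_norm_deriv_le_segment' (f := fun s => y s - s • θ s)
      (C := Tb + Z + 1) (a := 0) (b := t)
      (fun s _ => (hζd s).hasDerivWithinAt) (fun s hs => by
        have hsT : s ≤ T := hs.2.le.trans htT
        have b1 := hθT s hs.1 hsT
        have g1 : ‖ggn a (y s) (θ s)‖ ≤ D * Tb ^ 2 := by
          refine (hg _ _).trans ((div_le_self (by positivity) ?_).trans (by gcongr))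
          exact one_le_pow₀ (by linarith [norm_nonneg (y s)])
        have w1 : ‖WWn V (y s)‖ ≤ D := by
          refine (hW _).trans ?_
          have : (1 + ‖y s‖) ^ (κ - 1) ≤ 1 :=
            Real.rpow_le_one_of_one_le_of_nonpos (by linarith [norm_nonneg (y s)]) (by linarith)
          nlinarith
        have gw : ‖ggn a (y s) (θ s) - WWn V (y s)‖ ≤ D * Tb ^ 2 + D :=
          (norm_sub_le _ _).trans (add_le_add g1 w1)
        calc _ ≤ ‖ffn a (y s) (θ s)‖ + ‖s • (ggn a (y s) (θ s) - WWn V (y s))‖ := norm_sub_le _ _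
          _ ≤ D * Tb + T * (D * Tb ^ 2 + D) := by
            rw [norm_smul, Real.norm_of_nonneg hs.1]
            have := hf1 s
            have h2 : D * ‖θ s‖ ≤ D * Tb := by gcongr
            have h3 : s * ‖ggn a (y s) (θ s) - WWn V (y s)‖ ≤ T * (D * Tb ^ 2 + D) := by
              gcongr
            linarith
          _ ≤ Tb + Z + 1 := by linarith) t (Set.right_mem_Icc.2 ht)
    simpa using this

lemma sol_scale {n : ℕ} (a : Fin n → Fin n → (Fin n → ℝ) → ℝ) (W : (Fin n → ℝ) → Fin n → ℝ)
    (y θ : ℝ → Fin n → ℝ) (hS : Sol (ffn a) (ggn a) W y θ) (c : ℝ) :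
    Sol (ffn a) (ggn a) (c ^ 2 • W) (fun s => y (c * s)) (fun s => c • θ (c * s)) := by
  intro t
  have hc : HasDerivAt (fun s : ℝ => c * s) c t := by
    simpa using (hasDerivAt_id t).const_mul c
  constructor
  · refine ((hS (c * t)).1.scomp t hc).congr_deriv ?_
    rw [ffn_smul, smul_add]
  · refine (((hS (c * t)).2.scomp t hc).const_smul c).congr_deriv ?_
    simp only [ggn_smul, Pi.smul_apply, smul_sub, smul_smul, sq]

lemma half {n : ℕ} {a : Fin n → Fin n → (Fin n → ℝ) → ℝ} {V : (Fin n → ℝ) → ℝ}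
    {κ C : ℝ} (h : Coef a V κ C) (hN : NonTrap a) (hκ0 : 0 < κ) (hκ1 : κ < 1)
    (T : ℝ) (hT : 0 < T) (K : Set (Fin n → ℝ)) (hK : IsCompact K) :
    ∃ C' > 0, ∀ y θ y1 θ1 : ℝ → Fin n → ℝ, Sol (ffn a) (ggn a) 0 y θ →
      Sol (ffn a) (ggn a) (WWn V) y1 θ1 → y1 0 = y 0 → θ1 0 = θ 0 → y 0 ∈ K →
      ∀ t, 0 ≤ t → t ≤ T →
        ‖(y1 t - t • θ1 t) - (y t - t • θ t)‖ ≤ C' * t * Real.sqrt (1 + ‖θ 0‖ ^ 2) ^ (κ - 1) ∧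
        ‖θ1 t - θ t‖ ≤ C' * Real.sqrt (1 + ‖θ 0‖ ^ 2) ^ (κ - 1) := by
  obtain ⟨Λ, hΛ, hesc⟩ := uniform_escape h hN K hK
  obtain ⟨m, hm, M, hM, hbd⟩ := sol0_norm h hN
  obtain ⟨D, hD, hf, hg, hW, -, -⟩ := bounds_all h
  obtain ⟨A, hA, ε₀, hε₀, hpert⟩ := perturb (ffn a) (ggn a) (WWn V) κ D Λ M T hκ0 hκ1 hD.le hΛ
    hM.le hT hf hg hW
  set L := max 1 (1 / ε₀) with hL
  have hL1 : 1 ≤ L := le_max_left _ _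
  obtain ⟨B1, hB1, hsm1⟩ := small_regime h hN hκ1 T hT K hK L
  obtain ⟨B0, hB0, hsm0⟩ := small_regime h.zero hN hκ1 T hT K hK L
  rw [WWn_zero] at hsm0
  set q := (1 + L) ^ (κ - 1) with hq
  have hq0 : 0 < q := by positivity
  refine ⟨2 * A + (B1 + B0) / q, by positivity, ?_⟩
  intro y θ y1 θ1 hS hS1 hy hθ hyK t ht htT
  set J := Real.sqrt (1 + ‖θ 0‖ ^ 2) with hJ
  have hJ0 : 0 < J := by positivity
  have hJp : 0 < J ^ (κ - 1) := by positivity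
  have hbq : 0 ≤ (B1 + B0) / q := by positivity
  by_cases hlam : ‖θ 0‖ ≤ L
  · have hJL : J ≤ 1 + L := by
      rw [hJ, Real.sqrt_le_left (by positivity)]
      nlinarith [norm_nonneg (θ 0)]
    have hqJ : q ≤ J ^ (κ - 1) := Real.rpow_le_rpow_of_nonpos hJ0 hJL (by linarith)
    have h1 := hsm1 y1 θ1 hS1 (by rw [hy]; exact hyK) (by rw [hθ]; exact hlam) t ht htT
    have h0 := hsm0 y θ hS hyK hlam t ht htT
    have hkey : B1 + B0 ≤ (2 * A + (B1 + B0) / q) * J ^ (κ - 1) := by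
      calc B1 + B0 = (B1 + B0) / q * q := by field_simp
        _ ≤ (B1 + B0) / q * J ^ (κ - 1) := by gcongr
        _ ≤ _ := by gcongr; linarith
    constructor
    · have e : (y1 t - t • θ1 t) - (y t - t • θ t)
        = ((y1 t - t • θ1 t) - y1 0) - ((y t - t • θ t) - y 0) := by rw [hy]; abel
      rw [e]
      calc _ ≤ B1 * t + B0 * t := (norm_sub_le _ _).trans (add_le_add h1.2 h0.2)
        _ = (B1 + B0) * t := by ring
        _ ≤ (2 * A + (B1 + B0) / q) * J ^ (κ - 1) * t := by gcongr
        _ = _ := by ring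
    · exact (norm_sub_le _ _).trans ((add_le_add h1.1 h0.1).trans hkey)
  · push Not at hlam
    set lam := ‖θ 0‖ with hlamdef
    have hlam0 : 0 < lam := by linarith
    set ε := lam⁻¹ with hε
    have hε0 : 0 < ε := by positivity
    have hεle : ε ≤ ε₀ := by
      have h1 : 1 / ε₀ ≤ lam := (le_max_right _ _).trans hlam.le
      rw [hε]
      rw [div_le_iff₀ hε₀] at h1
      rw [inv_le_iff_one_le_mul₀ hlam0]
      linarith
    have hs0 : Sol (ffn a) (ggn a) 0 (fun s => y (ε * s)) (fun s => ε • θ (ε * s)) := by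
      simpa using sol_scale a 0 y θ hS ε
    have hs1 := sol_scale a (WWn V) y1 θ1 hS1 ε
    have hn1 : ‖(fun s => ε • θ (ε * s)) 0‖ = 1 := by
      show ‖ε • θ (ε * 0)‖ = 1
      rw [mul_zero, norm_smul, Real.norm_of_nonneg hε0.le, ← hlamdef, hε]
      exact inv_mul_cancel₀ hlam0.ne'
    have hετ : ε * (lam * t) = t := by rw [hε]; field_simp
    have hres := hpert ε hε0 hεle _ _ _ _ hs0 hs1 (by simp [hy]) (by simp [hθ])
      (fun τ _ => (hbd _ _ hs0 hn1 τ).2) (hesc _ _ hs0 hn1 (by simpa using hyK))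
      (lam * t) (by positivity) (by rw [hετ]; exact htT)
    simp only [hετ] at hres
    have hlε : lam * ε = 1 := by rw [hε]; exact mul_inv_cancel₀ hlam0.ne'
    have hεk : lam * ε ^ (2 - κ) ≤ 2 * J ^ (κ - 1) := by
      have e1 : lam * ε ^ (2 - κ) = ε ^ (1 - κ) := by
        have : (2 - κ) = 1 + (1 - κ) := by ring
        rw [this, Real.rpow_add hε0, Real.rpow_one, ← mul_assoc, hlε, one_mul]
      have hJl : J ≤ 2 * lam := by
        rw [hJ, Real.sqrt_le_left (by positivity)]
        nlinarith
      have e2 : ε ≤ 2 / J := by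
        rw [le_div_iff₀ hJ0]
        calc ε * J ≤ ε * (2 * lam) := by gcongr
          _ = 2 * (lam * ε) := by ring
          _ = 2 := by rw [hlε]; norm_num
      rw [e1]
      calc ε ^ (1 - κ) ≤ (2 / J) ^ (1 - κ) :=
            Real.rpow_le_rpow hε0.le e2 (by linarith)
        _ = (2:ℝ) ^ (1 - κ) * J ^ (κ - 1) := by
            rw [Real.div_rpow (by norm_num) hJ0.le, div_eq_mul_inv, ← Real.rpow_neg hJ0.le]
            congr 2; ring
        _ ≤ (2:ℝ) ^ (1:ℝ) * J ^ (κ - 1) := by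
            gcongr <;> [norm_num; linarith]
        _ = _ := by norm_num
    have hfin : A * (lam * ε ^ (2 - κ)) ≤ (2 * A + (B1 + B0) / q) * J ^ (κ - 1) := by
      calc _ ≤ A * (2 * J ^ (κ - 1)) := by gcongr
        _ = 2 * A * J ^ (κ - 1) := by ring
        _ ≤ _ := by gcongr; linarith
    constructor
    · have h1 := hres.2
      rw [smul_smul, smul_smul] at h1
      have e : lam * t * ε = t := by linear_combination t * hlε
      rw [e] at h1
      calc _ ≤ _ := h1
        _ = A * (lam * ε ^ (2 - κ)) * t := by ring
        _ ≤ (2 * A + (B1 + B0) / q) * J ^ (κ - 1) * t := by gcongr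
        _ = _ := by ring
    · have h1 := hres.1
      rw [← smul_sub, norm_smul, Real.norm_of_nonneg hε0.le] at h1
      calc ‖θ1 t - θ t‖ = lam * (ε * ‖θ1 t - θ t‖) := by rw [← mul_assoc, hlε, one_mul]
        _ ≤ lam * (A * ε ^ (2 - κ)) := by gcongr
        _ = A * (lam * ε ^ (2 - κ)) := by ring
        _ ≤ _ := hfin


/-- Lemma A.2, α=β=0: under Assumption 1.1 with 1 < μ < 2 and the
global nontrapping condition, writing
(z₁(t,x,ξ), η₁(t,x,ξ)) = exp(−tH_{p₀})∘exp(tH_p)(x,ξ) and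
(z(t,x,ξ), η(t,x,ξ)) = exp(−tH_{p₀})∘exp(tH_k)(x,ξ), for every T > 0 and compact K
there is C with |z₁ − z| ≤ C|t|⟨ξ⟩^{1−μ} and |η₁ − η| ≤ C⟨ξ⟩^{1−μ} for |t| ≤ T,
x ∈ K, ξ ∈ ℝⁿ.  Here exp(tH_k), exp(tH_p) are realized by the solution curves
(Y,Θ) and (Y₁,Θ₁) of the Hamilton ODEs, p = k + V, and
exp(−tH_{p₀})(y,η) = (y − tη, η). -/
theorem stmt_18 (n : ℕ) (μ : ℝ) (hμ1 : 1 < μ) (hμ2 : μ < 2)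
    (a : Fin n → Fin n → (Fin n → ℝ) → ℝ) (V : (Fin n → ℝ) → ℝ)
    (ha_smooth : ∀ j l, ContDiff ℝ (⊤ : ℕ∞) (a j l)) (hV_smooth : ContDiff ℝ (⊤ : ℕ∞) V)
    (C : ℕ → ℝ)
    (ha : ∀ (j l : Fin n) (m : ℕ) (x : Fin n → ℝ),
      ‖iteratedFDeriv ℝ m (fun y => a j l y - if j = l then 1 else 0) x‖
        ≤ C m * Real.sqrt (1 + ‖x‖ ^ 2) ^ (-μ - m))
    (hVb : ∀ (m : ℕ) (x : Fin n → ℝ),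
      ‖iteratedFDeriv ℝ m V x‖ ≤ C m * Real.sqrt (1 + ‖x‖ ^ 2) ^ (2 - μ - m))
    (Y Θ Y₁ Θ₁ : ℝ → (Fin n → ℝ) → (Fin n → ℝ) → (Fin n → ℝ))
    (hflow_k : ∀ (x ξ : Fin n → ℝ), Y 0 x ξ = x ∧ Θ 0 x ξ = ξ ∧
      ∀ t : ℝ, HasDerivAt (fun s => (Y s x ξ, Θ s x ξ))
        (hamVF n (kin n a) (Y t x ξ, Θ t x ξ)) t)
    (hflow_p : ∀ (x ξ : Fin n → ℝ), Y₁ 0 x ξ = x ∧ Θ₁ 0 x ξ = ξ ∧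
      ∀ t : ℝ, HasDerivAt (fun s => (Y₁ s x ξ, Θ₁ s x ξ))
        (hamVF n (fun z => kin n a z + V z.1) (Y₁ t x ξ, Θ₁ t x ξ)) t)
    (hnontrap : ∀ (x ξ : Fin n → ℝ), ξ ≠ 0 →
      Tendsto (fun t => ‖Y t x ξ‖) atTop atTop ∧
      Tendsto (fun t => ‖Y t x ξ‖) atBot atTop) :
    ∀ T > (0:ℝ), ∀ K : Set (Fin n → ℝ), IsCompact K →
      ∃ C' > 0, ∀ (t : ℝ) (x ξ : Fin n → ℝ), |t| ≤ T → x ∈ K →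
        ‖(Y₁ t x ξ - t • Θ₁ t x ξ) - (Y t x ξ - t • Θ t x ξ)‖
            ≤ C' * |t| * Real.sqrt (1 + ‖ξ‖ ^ 2) ^ (1 - μ) ∧
        ‖Θ₁ t x ξ - Θ t x ξ‖ ≤ C' * Real.sqrt (1 + ‖ξ‖ ^ 2) ^ (1 - μ) := by
  intro T hT K hK
  obtain ⟨D, hc⟩ := coef_of_assumption μ hμ1 hμ2 a V ha_smooth hV_smooth C ha hVb
  have hSk : ∀ x ξ, Sol (ffn a) (ggn a) 0 (fun s => Y s x ξ) (fun s => Θ s x ξ) := by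
    intro x ξ
    have h := (sol_iff a (fun _ => 0) hc.da (differentiable_const 0)
      (fun s => Y s x ξ) (fun s => Θ s x ξ)).2 (by
        intro t
        have h2 := (hflow_k x ξ).2.2 t
        have e : (fun z : (Fin n → ℝ) × (Fin n → ℝ) => kin n a z + (0:ℝ)) = kin n a := by
          funext z
          exact add_zero _
        show HasDerivAt (fun s => (Y s x ξ, Θ s x ξ))
          (hamVF n (fun z : (Fin n → ℝ) × (Fin n → ℝ) => kin n a z + (0:ℝ))
            (Y t x ξ, Θ t x ξ)) t
        rw [e]
        exact h2)
    rwa [WWn_zero] at h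
  have hSp : ∀ x ξ, Sol (ffn a) (ggn a) (WWn V) (fun s => Y₁ s x ξ) (fun s => Θ₁ s x ξ) :=
    fun x ξ => (sol_iff a V hc.da hc.dV _ _).2 (hflow_p x ξ).2.2
  have hN : NonTrap a := fun x ξ hξ =>
    ⟨fun s => Y s x ξ, fun s => Θ s x ξ, hSk x ξ, (hflow_k x ξ).1, (hflow_k x ξ).2.1,
      (hnontrap x ξ hξ).1⟩
  obtain ⟨C', hC', H⟩ := half hc hN (by linarith) (by linarith) T hT K hK
  refine ⟨C', hC', ?_⟩
  intro t x ξ ht hx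
  have hexp : 2 - μ - 1 = 1 - μ := by ring
  obtain ⟨k1, k2, _⟩ := hflow_k x ξ
  obtain ⟨q1, q2, _⟩ := hflow_p x ξ
  rcases le_total 0 t with h0 | h0
  · have := H _ _ _ _ (hSk x ξ) (hSp x ξ) (q1.trans k1.symm) (q2.trans k2.symm)
      (by rw [k1]; exact hx) t h0 (by rwa [abs_of_nonneg h0] at ht)
    simp only [k2, hexp] at this
    rwa [abs_of_nonneg h0]
  · have s1 := sol_scale a _ _ _ (hSk x ξ) (-1)
    have s2 := sol_scale a _ _ _ (hSp x ξ) (-1)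
    rw [smul_zero] at s1
    rw [show ((-1:ℝ) ^ 2) = 1 by norm_num, one_smul] at s2
    have := H _ _ _ _ s1 s2 (by simp [q1, k1]) (by simp [q2, k2])
      (by simpa [k1] using hx) (-t) (by linarith) (by rwa [abs_of_nonpos h0] at ht)
    simp only [mul_zero, k2, hexp, neg_mul, one_mul, neg_neg, neg_smul, one_smul, norm_neg,
      smul_neg] at this
    rw [abs_of_nonpos h0]
    refine ⟨by simpa using this.1, ?_⟩
    have h2 := this.2
    rwa [show -Θ₁ t x ξ - -Θ t x ξ = -(Θ₁ t x ξ - Θ t x ξ) by abel, norm_neg] at h2
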